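/- arXiv:2212.13112 — 6 statements merged into one kernel-verified Lean document; each statement's English description precedes it below -/
import Mathlib

section
/- Let n and m be nonnegative integers with m ≤ 2^n, and let a be the least element of {0,…,n} such that m < 2^{a+1} and a ≡ n (mod 2). Then Φ(n,m) ≤ √(2^{n+a}) + √(2^{n−a})·m − m. Furthermore, equality holds if 2^a − 2^{⌈a/2⌉} − 2^{⌊a/2⌋} + 2 ≤ m ≤ 2^a + 2^{⌈a/2⌉} + 2^{⌊a/2⌋} − 1. -/
open Finset

/-- The ground set `[n] = {1, …, n}`. -/
def groundSet (n : ℕ) : Finset ℕ := Finset.Icc 1 n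

/-- The up-closure `𝓕↑` of a family `F` with respect to ground set `X`. -/
def upClo (X : Finset ℕ) (F : Finset (Finset ℕ)) : Finset (Finset ℕ) :=
  X.powerset.filter (fun S => ∃ A ∈ F, A ⊆ S)

/-- The down-closure `𝓕↓` of a family `F` with respect to ground set `X`. -/
def downClo (X : Finset ℕ) (F : Finset (Finset ℕ)) : Finset (Finset ℕ) :=
  X.powerset.filter (fun S => ∃ A ∈ F, S ⊆ A)

/-- `𝓕↕ = 𝓕↑ ∪ 𝓕↓` with respect to ground set `X`. -/
def udClo (X : Finset ℕ) (F : Finset (Finset ℕ)) : Finset (Finset ℕ) :=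
  upClo X F ∪ downClo X F

/-- `Φ(n,m)`: the minimum of `|𝓕↕|` over families `𝓕 ⊆ 2^[n]` with `|𝓕| = m`,
closures taken w.r.t. the ground set `[n]`. -/
noncomputable def Phi (n m : ℕ) : ℕ :=
  sInf {k | ∃ F : Finset (Finset ℕ),
    F ⊆ (groundSet n).powerset ∧ F.card = m ∧ (udClo (groundSet n) F).card = k}

/-- The number of points of the `2 ^ n`-point Hammersley set (the permutation reversing `n` binary
digits) in a corner box with side lengths `u` and `d`. -/
def boxCount : ℕ → ℕ → ℕ → ℕ
  | 0, u, d => u * d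
  | n + 1, u, d =>
    if u ≤ 2 ^ n then boxCount n u (d / 2)
    else d / 2 + boxCount n (u - 2 ^ n) ((d + 1) / 2)

theorem boxCount_zero_left (n d : ℕ) : boxCount n 0 d = 0 := by
  induction n generalizing d with
  | zero => simp [boxCount]
  | succ n ih => simp [boxCount, ih]

theorem boxCount_full_left (n d : ℕ) : boxCount n (2 ^ n) d = d := by
  induction n generalizing d with
  | zero => simp [boxCount]
  | succ n ih =>
    have h : ¬ 2 ^ (n + 1) ≤ 2 ^ n := by
      rw [pow_succ]; have := Nat.two_pow_pos n; omega
    have h2 : 2 ^ (n + 1) - 2 ^ n = 2 ^ n := by rw [pow_succ]; omega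
    rw [boxCount, if_neg h, h2, ih]
    omega

theorem boxCount_succ_of_le {n u : ℕ} (h : u ≤ 2 ^ n) (d : ℕ) :
    boxCount (n + 1) u d = boxCount n u (d / 2) := by
  rw [boxCount, if_pos h]

theorem boxCount_succ_of_ge {n u : ℕ} (h : 2 ^ n ≤ u) (d : ℕ) :
    boxCount (n + 1) u d = d / 2 + boxCount n (u - 2 ^ n) ((d + 1) / 2) := by
  rcases h.eq_or_lt with rfl | h
  · rw [boxCount_succ_of_le le_rfl, boxCount_full_left, Nat.sub_self, boxCount_zero_left, add_zero]
  · rw [boxCount, if_neg (by omega)]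

theorem boxCount_mono_right (n u : ℕ) : Monotone (boxCount n u) := by
  induction n generalizing u with
  | zero => intro d e h; simp only [boxCount]; gcongr
  | succ n ih =>
    intro d e h
    have h1 := ih u (show d / 2 ≤ e / 2 by omega)
    have h2 := ih (u - 2 ^ n) (show (d + 1) / 2 ≤ (e + 1) / 2 by omega)
    simp only [boxCount]
    split_ifs <;> omega

theorem boxCount_succ_right_le {n u : ℕ} (hu : u ≤ 2 ^ n) (d : ℕ) :
    boxCount n u (d + 1) ≤ boxCount n u d + 1 := by
  induction n generalizing u d with
  | zero => simp only [boxCount, pow_zero] at *; nlinarith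
  | succ n ih =>
    rw [pow_succ] at hu
    rcases Nat.even_or_odd' d with ⟨c, rfl | rfl⟩
    · simp only [boxCount]
      rw [show (2 * c + 1) / 2 = c by omega, show 2 * c / 2 = c by omega,
        show (2 * c + 1 + 1) / 2 = c + 1 by omega]
      split_ifs
      · omega
      · have := ih (show u - 2 ^ n ≤ 2 ^ n by omega) c
        omega
    · simp only [boxCount]
      rw [show (2 * c + 1) / 2 = c by omega, show (2 * c + 1 + 1) / 2 = c + 1 by omega,
        show (2 * c + 1 + 1 + 1) / 2 = c + 1 by omega]
      split_ifs with h
      · exact ih h c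
      · omega

theorem boxCount_le_add_sub {n u : ℕ} (hu : u ≤ 2 ^ n) {d e : ℕ} (h : d ≤ e) :
    boxCount n u e ≤ boxCount n u d + (e - d) := by
  induction e, h using Nat.le_induction with
  | base => simp
  | succ e h ih =>
    have := boxCount_succ_right_le hu e
    omega

theorem boxCount_add_two_pow {n u d : ℕ} (hu : u ≤ 2 ^ n) (hd : d ≤ 2 ^ n) :
    boxCount n u d + 2 ^ n = u + d + boxCount n (2 ^ n - u) (2 ^ n - d) := by
  induction n generalizing u d with
  | zero =>
    simp only [pow_zero] at *
    interval_cases u <;> interval_cases d <;> simp [boxCount]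
  | succ n ih =>
    rw [pow_succ] at *
    rcases le_total u (2 ^ n) with h | h
    · have := ih h (show d / 2 ≤ 2 ^ n by omega)
      rw [boxCount_succ_of_le h, boxCount_succ_of_ge (by omega),
        show 2 ^ n * 2 - u - 2 ^ n = 2 ^ n - u by omega,
        show (2 ^ n * 2 - d + 1) / 2 = 2 ^ n - d / 2 by omega]
      omega
    · have := ih (show u - 2 ^ n ≤ 2 ^ n by omega) (show (d + 1) / 2 ≤ 2 ^ n by omega)
      rw [boxCount_succ_of_ge h, boxCount_succ_of_le (by omega),
        show 2 ^ n - (u - 2 ^ n) = 2 ^ n * 2 - u by omega,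
        show 2 ^ n - (d + 1) / 2 = (2 ^ n * 2 - d) / 2 by omega] at *
      omega

theorem boxCount_add_le {n u v d : ℕ} (h : u + v ≤ 2 ^ n) (hd : d ≤ 2 ^ n) :
    boxCount n u d + boxCount n v d ≤ boxCount n (u + v) d := by
  induction n generalizing u v d with
  | zero => simp only [boxCount]; exact (add_mul u v d).ge
  | succ n ih =>
    wlog huv : u ≤ v generalizing u v
    · rw [add_comm, add_comm u v]
      exact this (by omega) (by omega)
    rw [pow_succ] at *
    rcases le_total (u + v) (2 ^ n) with h1 | h1
    · rw [boxCount_succ_of_le h1, boxCount_succ_of_le (by omega), boxCount_succ_of_le (by omega)]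
      exact ih h1 (by omega)
    rw [boxCount_succ_of_ge h1]
    rcases le_total v (2 ^ n) with h2 | h2
    · rw [boxCount_succ_of_le h2, boxCount_succ_of_le (by omega)]
      have he : d / 2 ≤ 2 ^ n := by omega
      have hm := boxCount_mono_right n (u + v - 2 ^ n) (show d / 2 ≤ (d + 1) / 2 by omega)
      have e1 := boxCount_add_two_pow (huv.trans h2) he
      have e2 := boxCount_add_two_pow h2 he
      have e3 := boxCount_add_two_pow (show u + v - 2 ^ n ≤ 2 ^ n by omega) he
      have e4 := ih (u := 2 ^ n - u) (v := 2 ^ n - v) (by omega)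
        (show 2 ^ n - d / 2 ≤ 2 ^ n by omega)
      rw [show 2 ^ n - u + (2 ^ n - v) = 2 ^ n - (u + v - 2 ^ n) by omega] at e4
      omega
    · rw [boxCount_succ_of_ge h2, boxCount_succ_of_le (by omega)]
      have hm := boxCount_mono_right n u (show d / 2 ≤ (d + 1) / 2 by omega)
      have := ih (u := u) (v := v - 2 ^ n) (by omega) (show (d + 1) / 2 ≤ 2 ^ n by omega)
      rw [show u + (v - 2 ^ n) = u + v - 2 ^ n by omega] at this
      omega

theorem boxCount_symm {n u d : ℕ} (hu : u ≤ 2 ^ n) (hd : d ≤ 2 ^ n) :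
    boxCount n u d = boxCount n d u := by
  have key : ∀ n u d : ℕ, u ≤ 2 ^ (n + 1) → d ≤ 2 ^ (n + 1) →
      (d ≤ 2 ^ n → boxCount (n + 1) u d = boxCount n (u / 2) d) ∧
      (2 ^ n ≤ d → boxCount (n + 1) u d = u / 2 + boxCount n ((u + 1) / 2) (d - 2 ^ n)) := by
    intro n
    induction n with
    | zero =>
      intro u d hu hd
      norm_num at hu hd
      interval_cases u <;> interval_cases d <;> simp [boxCount]
    | succ n ih =>
      intro u d hu hd
      rw [pow_succ] at hu hd
      set N := 2 ^ (n + 1) with hN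
      have hN' : N = 2 ^ n * 2 := pow_succ _ _
      refine ⟨fun h => ?_, fun h => ?_⟩
      · rcases le_total u N with h1 | h1
        · rw [boxCount_succ_of_le h1, (ih u (d / 2) (by omega) (by omega)).1 (by omega),
            boxCount_succ_of_le (by omega)]
        · rw [boxCount_succ_of_ge h1, (ih (u - N) ((d + 1) / 2) (by omega) (by omega)).1 (by omega),
            boxCount_succ_of_ge (by omega), show (u - N) / 2 = u / 2 - 2 ^ n by omega]
      · rcases le_total u N with h1 | h1
        · rw [boxCount_succ_of_le h1, (ih u (d / 2) (by omega) (by omega)).2 (by omega),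
            boxCount_succ_of_le (by omega), show (d - N) / 2 = d / 2 - 2 ^ n by omega]
        · rw [boxCount_succ_of_ge h1, (ih (u - N) ((d + 1) / 2) (by omega) (by omega)).2 (by omega),
            boxCount_succ_of_ge (by omega), show (u - N + 1) / 2 = (u + 1) / 2 - 2 ^ n by omega,
            show (d + 1) / 2 - 2 ^ n = (d - N + 1) / 2 by omega]
          omega
  induction n generalizing u d with
  | zero => simp only [boxCount]; exact mul_comm _ _
  | succ n ih =>
    have hN' : 2 ^ (n + 1) = 2 ^ n * 2 := pow_succ _ _
    rcases le_total d (2 ^ n) with h | h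
    · rw [(key n u d hu hd).1 h, boxCount_succ_of_le h, ih (by omega) h]
    · rw [(key n u d hu hd).2 h, boxCount_succ_of_ge h, ih (by omega) (by omega)]

/-- The inequality that drives the induction on the ground set in `card_inter_le_boxCount`. -/
theorem boxCount_add_boxCount_le {n u₀ u₁ d₀ d₁ : ℕ} (hu : u₀ ≤ u₁) (hu₁ : u₁ ≤ 2 ^ n)
    (hd : d₁ ≤ d₀) (hd₀ : d₀ ≤ 2 ^ n) :
    boxCount n u₀ d₀ + boxCount n u₁ d₁ ≤ boxCount (n + 1) (u₀ + u₁) (d₀ + d₁) := by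
  induction n generalizing u₀ u₁ d₀ d₁ with
  | zero =>
    simp only [pow_zero] at *
    interval_cases u₁ <;> interval_cases u₀ <;> interval_cases d₀ <;> interval_cases d₁ <;>
      simp [boxCount]
  | succ n ih =>
    set N := 2 ^ (n + 1) with hN
    have hN' : N = 2 ^ n * 2 := pow_succ _ _
    have low : ∀ {u₀ u₁ d₀ d₁ : ℕ}, u₀ ≤ u₁ → u₁ ≤ N → d₁ ≤ d₀ → d₀ ≤ N → u₀ + u₁ ≤ N →
        boxCount (n + 1) u₀ d₀ + boxCount (n + 1) u₁ d₁ ≤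
          boxCount (n + 1) (u₀ + u₁) ((d₀ + d₁) / 2) := by
      intro u₀ u₁ d₀ d₁ hu hu₁ hd hd₀ h
      rcases le_total u₁ (2 ^ n) with h1 | h1
      · rw [boxCount_succ_of_le h1, boxCount_succ_of_le (by omega)]
        exact (ih hu h1 (by omega) (by omega)).trans (boxCount_mono_right _ _ (by omega))
      · rw [boxCount_succ_of_ge h1, boxCount_succ_of_le (by omega), boxCount_succ_of_ge (by omega)]
        set e := ((d₀ + d₁) / 2 + 1) / 2 with he
        have k1 := boxCount_mono_right n (u₁ - 2 ^ n) (show (d₁ + 1) / 2 ≤ e by omega)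
        have k2 := boxCount_add_le (u := u₀) (v := u₁ - 2 ^ n) (by omega)
          (show e ≤ 2 ^ n by omega)
        rw [show u₀ + (u₁ - 2 ^ n) = u₀ + u₁ - 2 ^ n by omega] at k2
        rcases le_total (d₀ / 2) e with h2 | h2
        · have k3 := boxCount_mono_right n u₀ h2
          omega
        · have k3 := boxCount_le_add_sub (show u₀ ≤ 2 ^ n by omega) h2
          omega
    rcases le_total (u₀ + u₁) N with h | h
    · rw [boxCount_succ_of_le h]
      exact low hu hu₁ hd hd₀ h
    · rw [boxCount_succ_of_ge h]
      have e1 := boxCount_add_two_pow (n := n + 1) (hu.trans hu₁) hd₀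
      have e2 := boxCount_add_two_pow (n := n + 1) hu₁ (hd.trans hd₀)
      have e3 := boxCount_add_two_pow (n := n + 1) (show u₀ + u₁ - 2 ^ (n + 1) ≤ _ by omega)
        (show (d₀ + d₁ + 1) / 2 ≤ 2 ^ (n + 1) by omega)
      have e4 := low (u₀ := N - u₁) (u₁ := N - u₀) (d₀ := N - d₁) (d₁ := N - d₀)
        (by omega) (by omega) (by omega) (by omega) (by omega)
      rw [show N - u₁ + (N - u₀) = N - (u₀ + u₁ - N) by omega,
        show (N - d₁ + (N - d₀)) / 2 = N - (d₀ + d₁ + 1) / 2 by omega] at e4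
      rw [← hN] at *
      omega

theorem exists_boxCount_le_mul {a u d : ℕ} (hu : u ≤ 2 ^ a) (hd : d ≤ 2 ^ a)
    (h : 0 < boxCount a (2 ^ a - u) (2 ^ a - d)) :
    ∃ i l, i + l = a ∧ boxCount a u d ≤ (2 ^ i - 1) * (2 ^ l - 1) ∧ d ≤ 2 ^ i * (2 ^ l - 1) := by
  induction a generalizing u d with
  | zero =>
    refine ⟨0, 0, rfl, ?_⟩
    simp only [pow_zero] at *
    interval_cases u <;> interval_cases d <;> simp [boxCount] at *
  | succ a ih =>
    rw [pow_succ] at *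
    rcases le_total (2 ^ a) u with h1 | h1
    · rw [boxCount_succ_of_le (by omega), show 2 ^ a * 2 - u = 2 ^ a - (u - 2 ^ a) by omega,
        show (2 ^ a * 2 - d) / 2 = 2 ^ a - (d + 1) / 2 by omega] at h
      obtain ⟨i, l, hil, k1, k2⟩ := ih (by omega) (by omega) h
      refine ⟨i + 1, l, by omega, ?_, ?_⟩
      · rw [boxCount_succ_of_ge h1]
        have hi := Nat.two_pow_pos i
        rw [pow_succ, show 2 ^ i * 2 - 1 = (2 ^ i - 1) + 2 ^ i by omega, add_mul]
        omega
      · rw [pow_succ, mul_right_comm]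
        omega
    · rw [boxCount_succ_of_ge (by omega), show 2 ^ a * 2 - u - 2 ^ a = 2 ^ a - u by omega,
        show (2 ^ a * 2 - d + 1) / 2 = 2 ^ a - d / 2 by omega] at h
      rcases Nat.eq_zero_or_pos (boxCount a (2 ^ a - u) (2 ^ a - d / 2)) with h0 | h0
      · have := boxCount_add_two_pow h1 (show d / 2 ≤ 2 ^ a by omega)
        refine ⟨1, a, by omega, ?_, ?_⟩
        · rw [boxCount_succ_of_le h1]
          omega
        · omega
      · obtain ⟨i, l, hil, k1, k2⟩ := ih h1 (by omega) h0
        refine ⟨i, l + 1, by omega, ?_, ?_⟩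
        · rw [boxCount_succ_of_le h1]
          exact k1.trans (Nat.mul_le_mul_left _ (by rw [pow_succ]; omega))
        · have hi := Nat.two_pow_pos i
          have hl := Nat.two_pow_pos l
          rw [pow_succ, show 2 ^ l * 2 - 1 = (2 ^ l - 1) + (2 ^ l - 1) + 1 by omega, mul_add, mul_add]
          omega

theorem boxCount_add_right {n u : ℕ} (hu : u ≤ 2 ^ n) (k d : ℕ) :
    boxCount (n + k) u d = boxCount n u (d / 2 ^ k) := by
  induction k generalizing d with
  | zero => simp
  | succ k ih =>
    rw [← add_assoc, boxCount_succ_of_le (hu.trans (Nat.pow_le_pow_right two_pos (by omega))), ih,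
      Nat.div_div_eq_div_mul, pow_succ']

theorem boxCount_add_add {n j k u d : ℕ} (hu : u ≤ 2 ^ (n + j)) (hd : d ≤ 2 ^ (n + k)) :
    boxCount (n + j + k) u d = boxCount n (u / 2 ^ j) (d / 2 ^ k) := by
  have hd' : d / 2 ^ k ≤ 2 ^ n := Nat.div_le_of_le_mul (by rwa [← pow_add, add_comm k])
  have hu' : u / 2 ^ j ≤ 2 ^ n := Nat.div_le_of_le_mul (by rwa [← pow_add, add_comm j])
  rw [boxCount_add_right hu,
    boxCount_symm hu (hd'.trans (Nat.pow_le_pow_right two_pos (by omega))),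
    boxCount_add_right hd', boxCount_symm hd' hu']

theorem two_pow_half_add_le {a i l : ℕ} (h : i + l = a) :
    2 ^ ((a + 1) / 2) + 2 ^ (a / 2) ≤ 2 ^ i + 2 ^ l := by
  wlog hil : i ≤ l generalizing i l
  · rw [add_comm (2 ^ i)]
    exact this (by omega) (by omega)
  obtain ⟨r, hr⟩ : ∃ r, a / 2 = i + r := ⟨a / 2 - i, by omega⟩
  obtain ⟨s, hs⟩ : ∃ s, (a + 1) / 2 = i + s := ⟨(a + 1) / 2 - i, by omega⟩
  have hl : l = i + (r + s) := by omega
  rw [hl, hr, hs, pow_add, pow_add, pow_add, pow_add]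
  obtain ⟨x, hx⟩ : ∃ x, 2 ^ r = x + 1 := ⟨2 ^ r - 1, by have := Nat.two_pow_pos r; omega⟩
  obtain ⟨y, hy⟩ : ∃ y, 2 ^ s = y + 1 := ⟨2 ^ s - 1, by have := Nat.two_pow_pos s; omega⟩
  rw [hx, hy]
  nlinarith [Nat.zero_le (2 ^ i * (x * y))]

theorem boxCount_add_le_of_pos {a u d : ℕ} (hu : u ≤ 2 ^ a) (hd : d ≤ 2 ^ a)
    (h : u + d < boxCount a u d + 2 ^ a) :
    boxCount a u d + 2 ^ ((a + 1) / 2) + 2 ^ (a / 2) ≤ 2 ^ a + 1 := by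
  have h1 := boxCount_add_two_pow hu hd
  obtain ⟨i, l, hil, h2, -⟩ := exists_boxCount_le_mul hu hd (by omega)
  have h3 := two_pow_half_add_le hil
  have h4 : (2 ^ i - 1) * (2 ^ l - 1) + 2 ^ i + 2 ^ l = 2 ^ a + 1 := by
    rw [← hil, pow_add]
    obtain ⟨x, hx⟩ : ∃ x, 2 ^ i = x + 1 := ⟨2 ^ i - 1, by have := Nat.two_pow_pos i; omega⟩
    obtain ⟨y, hy⟩ : ∃ y, 2 ^ l = y + 1 := ⟨2 ^ l - 1, by have := Nat.two_pow_pos l; omega⟩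
    rw [hx, hy, Nat.add_sub_cancel, Nat.add_sub_cancel]
    ring
  omega

theorem two_pow_mul_add_boxCount_le {a k u d : ℕ} (hu : u ≤ 2 ^ (a + k + k))
    (hu' : 2 ^ (a + k) ≤ u) (hd : d ≤ 2 ^ (a + k)) :
    2 ^ k * (2 ^ a + boxCount (a + k + k) u d) ≤ u + d := by
  have hle : 2 ^ a ≤ 2 ^ (a + k) := Nat.pow_le_pow_right two_pos (by omega)
  have h1 : 2 ^ a ≤ u / 2 ^ k := by
    rwa [Nat.le_div_iff_mul_le (Nat.two_pow_pos k), ← pow_add]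
  have h2 := boxCount_le_add_sub hd h1
  rw [boxCount_symm hd hle, boxCount_add_right le_rfl, boxCount_full_left] at h2
  rw [boxCount_symm hu (hd.trans (Nat.pow_le_pow_right two_pos (by omega))), boxCount_add_right hd]
  calc 2 ^ k * (2 ^ a + boxCount (a + k) d (u / 2 ^ k))
      ≤ 2 ^ k * (d / 2 ^ k + u / 2 ^ k) := Nat.mul_le_mul_left _ (by omega)
    _ ≤ u + d := by
      rw [mul_add]
      have := Nat.mul_div_le u (2 ^ k)
      have := Nat.mul_div_le d (2 ^ k)
      omega

/-- Lower bound for the perimeter of a corner box containing at least `t` points of the Hammersley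
set, for `t` close to `2 ^ a`. -/
theorem two_pow_mul_add_le_of_le_boxCount {a k u d t : ℕ} (hu : u ≤ 2 ^ (a + k + k))
    (hd : d ≤ 2 ^ (a + k + k)) (ht : t ≤ boxCount (a + k + k) u d)
    (hlo : 2 ^ a + 2 ≤ t + 2 ^ ((a + 1) / 2) + 2 ^ (a / 2))
    (hhi : t + 1 ≤ 2 ^ a + 2 ^ ((a + 1) / 2) + 2 ^ (a / 2)) :
    2 ^ k * (2 ^ a + t) ≤ u + d := by
  have hK : 0 < 2 ^ k := Nat.two_pow_pos k
  have hKM : 2 ^ (a + k) = 2 ^ k * 2 ^ a := by rw [add_comm, pow_add]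
  by_contra! hlt
  have hu' := Nat.mul_div_le u (2 ^ k)
  have hd' := Nat.mul_div_le d (2 ^ k)
  rcases le_total u (2 ^ (a + k)) with h1 | h1 <;> rcases le_total d (2 ^ (a + k)) with h2 | h2
  · rw [boxCount_add_add h1 h2] at ht
    have h3 : u / 2 ^ k + d / 2 ^ k < 2 ^ a + t := by
      refine lt_of_mul_lt_mul_left ?_ hK.le
      rw [mul_add]
      omega
    have := boxCount_add_le_of_pos (a := a) (Nat.div_le_of_le_mul (hKM ▸ h1))
      (Nat.div_le_of_le_mul (hKM ▸ h2)) (by omega)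
    omega
  · have := two_pow_mul_add_boxCount_le hd h2 h1
    rw [← boxCount_symm hu hd] at this
    have := Nat.mul_le_mul_left (2 ^ k) (Nat.add_le_add_left ht (2 ^ a))
    omega
  · have := two_pow_mul_add_boxCount_le hu h1 h2
    have := Nat.mul_le_mul_left (2 ^ k) (Nat.add_le_add_left ht (2 ^ a))
    omega
  · have ht2 : t ≤ 2 ^ a * 2 := by
      have := two_pow_half_add_le (zero_add a)
      omega
    have hsum : u + d < 2 ^ (a + k) + 2 ^ k * t := by rwa [hKM, ← mul_add]
    have hKt := Nat.mul_le_mul_left (2 ^ k) ht2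
    rw [← mul_assoc, ← hKM] at hKt
    obtain _ | j := k
    · simp only [add_zero, pow_zero, one_mul] at *
      have hbox := boxCount_add_two_pow hu hd
      rw [show u = 2 ^ a by omega, show d = 2 ^ a by omega, boxCount_full_left] at ht
      omega
    have hj : 2 ^ (j + 1) = 2 ^ j * 2 := pow_succ _ _
    have hj0 : 0 < 2 ^ j := Nat.two_pow_pos j
    have e1 : 2 ^ (a + 2 + j) = 2 ^ (a + (j + 1)) * 2 := by
      rw [← pow_succ]; congr 1; omega
    have e2 : 2 ^ (a + 2 + j) = 2 ^ j * (2 ^ a * 4) := by ring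
    have e3 : 2 ^ (a + 2) = 2 ^ a * 4 := by ring
    have e4 : 2 ^ (a + 1) = 2 ^ a * 2 := by ring
    have e5 : 2 ^ (a + (j + 1)) = 2 ^ j * (2 ^ a * 2) := by ring
    have h1' : u ≤ 2 ^ (a + 2 + j) := by omega
    have h2' : d ≤ 2 ^ (a + 2 + j) := by omega
    rw [show a + (j + 1) + (j + 1) = a + 2 + j + j by omega, boxCount_add_add h1' h2'] at ht
    have hp1 : u / 2 ^ j ≤ 2 ^ a * 4 := Nat.div_le_of_le_mul (e2 ▸ h1')
    have hq1 : d / 2 ^ j ≤ 2 ^ a * 4 := Nat.div_le_of_le_mul (e2 ▸ h2')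
    have hp2 : 2 ^ a * 2 ≤ u / 2 ^ j := by
      rwa [Nat.le_div_iff_mul_le hj0, mul_comm, ← e5]
    have hq2 : 2 ^ a * 2 ≤ d / 2 ^ j := by
      rwa [Nat.le_div_iff_mul_le hj0, mul_comm, ← e5]
    have hpq : u / 2 ^ j + d / 2 ^ j < 2 * (2 ^ a + t) := by
      refine lt_of_mul_lt_mul_left (a := 2 ^ j) ?_ hj0.le
      rw [← mul_assoc, ← hj, mul_add]
      exact (add_le_add (Nat.mul_div_le u (2 ^ j)) (Nat.mul_div_le d (2 ^ j))).trans_lt hlt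
    generalize u / 2 ^ j = p at *
    generalize d / 2 ^ j = q at *
    have c1 := boxCount_add_two_pow (n := a + 2) (u := p) (d := q) (e3 ▸ hp1) (e3 ▸ hq1)
    have c0 : boxCount (a + 2) (2 ^ a * 4 - p) (2 ^ a * 4 - q) =
        boxCount a ((2 ^ a * 4 - p) / 2 ^ 1) ((2 ^ a * 4 - q) / 2 ^ 1) :=
      boxCount_add_add (n := a) (j := 1) (k := 1) (by omega) (by omega)
    rw [e3, c0, pow_one] at c1
    have c2 : (2 ^ a * 4 - p) / 2 ≤ 2 ^ a := by omega
    have c3 : (2 ^ a * 4 - q) / 2 ≤ 2 ^ a := by omega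
    have c4 := boxCount_add_le_of_pos c2 c3 (by omega)
    omega

/-- An upset and a downset of the power set of `X` meet in at most `boxCount` many sets. -/
theorem card_inter_le_boxCount {α : Type*} [DecidableEq α] (X : Finset α) {U D : Finset (Finset α)}
    (hUX : U ⊆ X.powerset) (hDX : D ⊆ X.powerset)
    (hU : ∀ S ∈ U, ∀ T ⊆ X, S ⊆ T → T ∈ U) (hD : ∀ S ∈ D, ∀ T ⊆ S, T ∈ D) :
    #(U ∩ D) ≤ boxCount #X #U #D := by
  induction X using Finset.induction_on generalizing U D with
  | empty =>
    rw [powerset_empty, subset_singleton_iff] at hUX hDX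
    rcases hUX with rfl | rfl <;> rcases hDX with rfl | rfl <;> simp [boxCount]
  | insert p X hp ih =>
    have sub_mem : ∀ {A : Finset (Finset α)}, A ⊆ (insert p X).powerset →
        A.memberSubfamily p ⊆ X.powerset := fun hA S hS => by
      rw [mem_memberSubfamily] at hS
      have := mem_powerset.1 (hA hS.1)
      exact mem_powerset.2 ((subset_insert_iff_of_notMem hS.2).1 ((subset_insert p S).trans this))
    have sub_non : ∀ {A : Finset (Finset α)}, A ⊆ (insert p X).powerset →
        A.nonMemberSubfamily p ⊆ X.powerset := fun hA S hS => by
      rw [mem_nonMemberSubfamily] at hS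
      exact mem_powerset.2 ((subset_insert_iff_of_notMem hS.2).1 (mem_powerset.1 (hA hS.1)))
    have h₀ := ih (sub_non hUX) (sub_non hDX)
      (fun S hS T hT hST => by
        rw [mem_nonMemberSubfamily] at hS ⊢
        exact ⟨hU S hS.1 T (hT.trans (subset_insert p X)) hST, fun h => hp (hT h)⟩)
      (fun S hS T hT => by
        rw [mem_nonMemberSubfamily] at hS ⊢
        exact ⟨hD S hS.1 T hT, fun h => hS.2 (hT h)⟩)
    have h₁ := ih (sub_mem hUX) (sub_mem hDX)
      (fun S hS T hT hST => by
        rw [mem_memberSubfamily] at hS ⊢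
        exact ⟨hU _ hS.1 _ (insert_subset_insert p hT) (insert_subset_insert p hST),
          fun h => hp (hT h)⟩)
      (fun S hS T hT => by
        rw [mem_memberSubfamily] at hS ⊢
        exact ⟨hD _ hS.1 _ (insert_subset_insert p hT), fun h => hS.2 (hT h)⟩)
    have hu : #(U.nonMemberSubfamily p) ≤ #(U.memberSubfamily p) := card_le_card fun S hS => by
      have hSX := mem_powerset.1 (sub_non hUX hS)
      rw [mem_nonMemberSubfamily] at hS
      rw [mem_memberSubfamily]
      exact ⟨hU S hS.1 _ (insert_subset_insert p hSX) (subset_insert p S), hS.2⟩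
    have hd : #(D.memberSubfamily p) ≤ #(D.nonMemberSubfamily p) := card_le_card fun S hS => by
      rw [mem_memberSubfamily] at hS
      rw [mem_nonMemberSubfamily]
      exact ⟨hD _ hS.1 S (subset_insert p S), hS.2⟩
    have hu₁ := card_le_card (sub_mem hUX)
    have hd₀ := card_le_card (sub_non hDX)
    rw [card_powerset] at hu₁ hd₀
    have := boxCount_add_boxCount_le hu hu₁ hd hd₀
    rw [← memberSubfamily_inter] at h₁
    rw [← nonMemberSubfamily_inter] at h₀
    rw [← card_memberSubfamily_add_card_nonMemberSubfamily p (U ∩ D), card_insert_of_notMem hp,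
      ← card_memberSubfamily_add_card_nonMemberSubfamily p U,
      ← card_memberSubfamily_add_card_nonMemberSubfamily p D,
      add_comm #(memberSubfamily p U), add_comm #(memberSubfamily p D)]
    omega

theorem exists_upper_subfamily_card_inter_eq {α : Type*} [DecidableEq α] {X : Finset α}
    {U D : Finset (Finset α)} (hU : ∀ S ∈ U, ∀ T ⊆ X, S ⊆ T → T ∈ U) {m : ℕ}
    (hm : m ≤ #(U ∩ D)) :
    ∃ V ⊆ U, (∀ S ∈ V, ∀ T ⊆ X, S ⊆ T → T ∈ V) ∧ #(V ∩ D) = m := by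
  induction hc : #U generalizing U with
  | zero =>
    rw [card_eq_zero] at hc
    subst hc
    exact ⟨∅, Subset.rfl, by simp, by simpa [eq_comm] using hm⟩
  | succ c ih =>
    obtain h | h := hm.eq_or_lt
    · exact ⟨U, Subset.rfl, hU, h.symm⟩
    obtain ⟨S, hS, hmin⟩ := exists_min_image U card (card_pos.1 (by omega))
    obtain ⟨V, hVU, hV⟩ := ih (U := U.erase S)
      (fun R hR T hT hRT => by
        rw [mem_erase] at hR ⊢
        refine ⟨?_, hU R hR.2 T hT hRT⟩
        rintro rfl
        exact hR.1 (eq_of_subset_of_card_le hRT (hmin R hR.2)))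
      (by
        rw [erase_inter]
        have := pred_card_le_card_erase (s := U ∩ D) (a := S)
        omega)
      (by rw [card_erase_of_mem hS, hc, Nat.add_sub_cancel])
    exact ⟨V, hVU.trans (erase_subset S U), hV⟩

theorem exists_lower_family_card_eq {α : Type*} [DecidableEq α] (Y : Finset α) {m : ℕ}
    (hm : m ≤ 2 ^ #Y) :
    ∃ D ⊆ Y.powerset, (∀ S ∈ D, ∀ T ⊆ S, T ∈ D) ∧ #D = m := by
  induction m with
  | zero => exact ⟨∅, by simp⟩
  | succ m ih =>
    obtain ⟨D, hDY, hD, hc⟩ := ih (by omega)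
    have hne : (Y.powerset \ D).Nonempty := by
      rw [← card_pos, card_sdiff_of_subset hDY, card_powerset]
      omega
    obtain ⟨S, hS, hmin⟩ := exists_min_image _ card hne
    rw [mem_sdiff] at hS
    refine ⟨insert S D, insert_subset hS.1 hDY, fun R hR T hT => ?_, ?_⟩
    · rw [mem_insert] at hR ⊢
      obtain rfl | hR := hR
      · by_contra! h
        have hT' := hmin T (mem_sdiff.2
          ⟨mem_powerset.2 (hT.trans (mem_powerset.1 hS.1)), h.2⟩)
        exact h.1 (eq_of_subset_of_card_le hT hT')
      · exact Or.inr (hD R hR T hT)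
    · rw [card_insert_of_notMem hS.2, hc]

/-- A family of size `m` with small up-down closure: the sets between `[k]` and `[n]` whose trace on
the complement of `[k]` lies in a down-closed family of size `m`. -/
theorem exists_card_udClo_le {n m k b : ℕ} (hn : k + b = n) (hm : m ≤ 2 ^ b) :
    ∃ F ⊆ (groundSet n).powerset, #F = m ∧ #(udClo (groundSet n) F) + m ≤ 2 ^ b + 2 ^ k * m := by
  set A := Icc 1 k with hA
  set Y := Icc (k + 1) n with hY
  have hAc : #A = k := by simp [hA]
  have hYc : #Y = b := by rw [hY, Nat.card_Icc]; omega
  have hAY : Disjoint A Y := disjoint_left.2 fun x hx hy => by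
    rw [hA, mem_Icc] at hx
    rw [hY, mem_Icc] at hy
    omega
  have hX : groundSet n = Y ∪ A := by
    ext x
    simp only [groundSet, hA, hY, mem_union, mem_Icc]
    omega
  obtain ⟨D, hDY, hD, hDm⟩ := exists_lower_family_card_eq Y (hYc ▸ hm)
  set F := D.image (· ∪ A) with hF
  set P := Y.powerset.image (· ∪ A) with hP
  set Q := (D ×ˢ A.powerset).image (fun x => x.1 ∪ x.2) with hQ
  have hFm : #F = m := by
    rw [hF, card_image_of_injOn, hDm]
    intro S hS T hT h
    have hS' := hAY.mono_right (mem_powerset.1 (hDY hS))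
    have hT' := hAY.mono_right (mem_powerset.1 (hDY hT))
    have h' : S ∪ A = T ∪ A := h
    rw [← union_sdiff_cancel_right hS'.symm, h', union_sdiff_cancel_right hT'.symm]
  have hFP : F ⊆ P := image_subset_image hDY
  have hFQ : F ⊆ Q := image_subset_iff.2 fun S hS =>
    mem_image.2 ⟨(S, A), mem_product.2 ⟨hS, mem_powerset_self A⟩, rfl⟩
  have hPc : #P ≤ 2 ^ b := card_image_le.trans (by rw [card_powerset, hYc])
  have hQc : #Q ≤ 2 ^ k * m := card_image_le.trans
    (by rw [card_product, card_powerset, hDm, hAc, mul_comm])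
  have hsub : udClo (groundSet n) F ⊆ P ∪ Q := by
    rw [udClo, hX]
    refine union_subset_union (fun S hS => ?_) fun S hS => ?_
    · obtain ⟨hS, B, hB, hBS⟩ := mem_filter.1 hS
      obtain ⟨R, -, rfl⟩ := mem_image.1 hB
      refine mem_image.2 ⟨S ∩ Y, mem_powerset.2 inter_subset_right, ?_⟩
      have hAS : A ⊆ S := subset_union_right.trans hBS
      change S ∩ Y ∪ A = S
      rw [inter_union_distrib_right, union_eq_left.2 hAS, inter_eq_left]
      exact mem_powerset.1 hS
    · obtain ⟨-, B, hB, hBS⟩ := mem_filter.1 hS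
      obtain ⟨R, hR, rfl⟩ := mem_image.1 hB
      refine mem_image.2 ⟨(S ∩ R, S ∩ A), mem_product.2
        ⟨hD R hR _ inter_subset_right, mem_powerset.2 inter_subset_right⟩, ?_⟩
      change S ∩ R ∪ S ∩ A = S
      rw [← inter_union_distrib_left, inter_eq_left]
      exact hBS
  refine ⟨F, fun S hS => ?_, hFm, ?_⟩
  · obtain ⟨R, hR, rfl⟩ := mem_image.1 hS
    rw [mem_powerset, hX]
    exact union_subset_union_left (mem_powerset.1 (hDY hR))
  · have h1 := card_le_card hsub
    have h2 := card_union_add_card_inter P Q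
    have h3 := card_le_card (subset_inter hFP hFQ)
    omega

theorem exists_card_add_card_le_card_udClo {n : ℕ} {F : Finset (Finset ℕ)}
    (hF : F ⊆ (groundSet n).powerset) :
    ∃ u ≤ 2 ^ n, ∃ d ≤ 2 ^ n, #F ≤ boxCount n u d ∧ u + d ≤ #(udClo (groundSet n) F) + #F := by
  have hX : #(groundSet n) = n := by simp [groundSet]
  have hU : ∀ S ∈ upClo (groundSet n) F, ∀ T ⊆ groundSet n, S ⊆ T → T ∈ upClo (groundSet n) F :=
    fun S hS T hT hST => by
      obtain ⟨-, A, hA, hAS⟩ := mem_filter.1 hS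
      exact mem_filter.2 ⟨mem_powerset.2 hT, A, hA, hAS.trans hST⟩
  have hD : ∀ S ∈ downClo (groundSet n) F, ∀ T ⊆ S, T ∈ downClo (groundSet n) F :=
    fun S hS T hT => by
      obtain ⟨hSX, A, hA, hAS⟩ := mem_filter.1 hS
      exact mem_filter.2 ⟨mem_powerset.2 (hT.trans (mem_powerset.1 hSX)), A, hA, hT.trans hAS⟩
  have hUX : upClo (groundSet n) F ⊆ (groundSet n).powerset := filter_subset _ _
  have hDX : downClo (groundSet n) F ⊆ (groundSet n).powerset := filter_subset _ _
  have hFUD : F ⊆ upClo (groundSet n) F ∩ downClo (groundSet n) F := fun S hS =>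
    mem_inter.2 ⟨mem_filter.2 ⟨hF hS, S, hS, Subset.rfl⟩, mem_filter.2 ⟨hF hS, S, hS, Subset.rfl⟩⟩
  obtain ⟨V, hVU, hV, hVm⟩ := exists_upper_subfamily_card_inter_eq hU (card_le_card hFUD)
  have h1 := card_inter_le_boxCount (groundSet n) (hVU.trans hUX) hDX hV hD
  rw [hX, hVm] at h1
  refine ⟨#V, ?_, #(downClo (groundSet n) F), ?_, h1, ?_⟩
  · simpa [hX] using card_le_card (hVU.trans hUX)
  · simpa [hX] using card_le_card hDX
  · rw [← card_union_add_card_inter, hVm, udClo]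
    exact Nat.add_le_add_right (card_le_card (union_subset_union_left hVU)) _

/-- Corollary 15: with `a` the least element of `{0,…,n}` such that `m < 2^(a+1)` and
`a ≡ n (mod 2)`, we have `Φ(n,m) ≤ 2^((n+a)/2) + 2^((n-a)/2) m - m`, with equality
whenever `2^a - 2^⌈a/2⌉ - 2^⌊a/2⌋ + 2 ≤ m ≤ 2^a + 2^⌈a/2⌉ + 2^⌊a/2⌋ - 1`. -/
theorem stmt14 (n m : ℕ) (hm : m ≤ 2 ^ n) (a : ℕ)
    (ha : IsLeast {b : ℕ | b ≤ n ∧ m < 2 ^ (b + 1) ∧ b % 2 = n % 2} a) :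
    Phi n m ≤ 2 ^ ((n + a) / 2) + 2 ^ ((n - a) / 2) * m - m ∧
    ((2 : ℤ) ^ a - 2 ^ ((a + 1) / 2) - 2 ^ (a / 2) + 2 ≤ (m : ℤ) ∧
        (m : ℤ) ≤ 2 ^ a + 2 ^ ((a + 1) / 2) + 2 ^ (a / 2) - 1 →
      Phi n m = 2 ^ ((n + a) / 2) + 2 ^ ((n - a) / 2) * m - m) := by
  obtain ⟨⟨han, hma, hmod⟩, -⟩ := ha
  obtain ⟨k, rfl⟩ : ∃ k, n = a + k + k := ⟨(n - a) / 2, by omega⟩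
  have hmk : m ≤ 2 ^ (a + k) := by
    obtain rfl | hk := k.eq_zero_or_pos
    · exact hm
    · exact hma.le.trans (Nat.pow_le_pow_right two_pos (by omega))
  rw [show (a + k + k + a) / 2 = a + k by omega, show (a + k + k - a) / 2 = k by omega]
  obtain ⟨F, hF, hFm, hFc⟩ := exists_card_udClo_le (n := a + k + k) (add_comm k (a + k)) hmk
  have hle : Phi (a + k + k) m ≤ 2 ^ (a + k) + 2 ^ k * m - m := by
    have hPhi : Phi (a + k + k) m ≤ #(udClo (groundSet (a + k + k)) F) :=
      Nat.sInf_le ⟨F, hF, hFm, rfl⟩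
    omega
  refine ⟨hle, fun ⟨hlo, hhi⟩ => hle.antisymm ?_⟩
  obtain ⟨G, hG, hGm, hGc⟩ := Nat.sInf_mem (s := {k' | ∃ F : Finset (Finset ℕ),
    F ⊆ (groundSet (a + k + k)).powerset ∧ #F = m ∧ #(udClo (groundSet (a + k + k)) F) = k'})
    ⟨_, F, hF, hFm, rfl⟩
  obtain ⟨u, hu, d, hd, hbox, hud⟩ := exists_card_add_card_le_card_udClo hG
  rw [hGm] at hbox hud
  have hmain := two_pow_mul_add_le_of_le_boxCount hu hd hbox (by zify; linarith)
    (by zify; linarith)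
  rw [mul_add, ← pow_add, add_comm k a] at hmain
  rw [Phi, ← hGc]
  omega
end

section
/- The functions δ_k satisfy: (i) δ_k(0) = 0 and δ_k(k) = 1 for all integers k ≥ 1; (ii) 2^t·δ_{2^t}(x) = x for all integers t ≥ 0 and x ∈ {0,…,2^t}; (iii) 2^t·δ_{2^t−1}(x) = x + 1 for all integers t ≥ 1 and x ∈ {1,…,2^t−1}; (iv) 2^t·δ_k(x+1) − (x+1) ≥ 2^t·δ_k(x) − x for all integers k, t, x with 1 ≤ k ≤ 2^t and x ∈ {0,…,k−1}. -/
open Finset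

/-- The function `δ_k` (the value for `k = 0` is junk). For `k ≥ 2`,
`δ_k(x) = δ_{⌊k/2⌋}(x)/2` if `x < ⌊k/2⌋` and
`δ_k(x) = 1/2 + δ_{⌈k/2⌉}(x - ⌊k/2⌋)/2` otherwise. -/
def delta : ℕ → ℕ → ℚ
  | 0, x => x
  | 1, x => x
  | k + 2, x =>
      if x < (k + 2) / 2 then (1 / 2) * delta ((k + 2) / 2) x
      else 1 / 2 + (1 / 2) * delta ((k + 3) / 2) (x - (k + 2) / 2)
termination_by k _ => k
decreasing_by all_goals omega

theorem delta_of_lt {k x : ℕ} (hk : 2 ≤ k) (hx : x < k / 2) :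
    delta k x = 1 / 2 * delta (k / 2) x := by
  obtain ⟨k, rfl⟩ := Nat.exists_eq_add_of_le' hk
  rw [delta, if_pos hx]

theorem delta_of_le {k x : ℕ} (hk : 2 ≤ k) (hx : k / 2 ≤ x) :
    delta k x = 1 / 2 + 1 / 2 * delta ((k + 1) / 2) (x - k / 2) := by
  obtain ⟨k, rfl⟩ := Nat.exists_eq_add_of_le' hk
  rw [delta, if_neg hx.not_gt]

theorem delta_zero_right (k : ℕ) : delta k 0 = 0 := by
  induction k using Nat.strong_induction_on with
  | _ k ih =>
    rcases lt_or_ge k 2 with hk | hk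
    · interval_cases k <;> simp [delta]
    · rw [delta_of_lt hk (by omega), ih _ (by omega), mul_zero]

theorem delta_self {k : ℕ} (h : 1 ≤ k) : delta k k = 1 := by
  induction k using Nat.strong_induction_on with
  | _ k ih =>
    rcases lt_or_ge k 2 with hk | hk
    · obtain rfl : k = 1 := by omega
      simp [delta]
    · rw [delta_of_le hk (by omega), show k - k / 2 = (k + 1) / 2 by omega,
        ih _ (by omega) (by omega)]
      norm_num

theorem two_pow_mul_delta_two_pow {t x : ℕ} (hx : x ≤ 2 ^ t) :
    (2 : ℚ) ^ t * delta (2 ^ t) x = x := by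
  induction t generalizing x with
  | zero => simp [delta]
  | succ t ih =>
    have hpos : 0 < 2 ^ t := by positivity
    have hfloor : 2 ^ (t + 1) / 2 = 2 ^ t := by omega
    have hceil : (2 ^ (t + 1) + 1) / 2 = 2 ^ t := by omega
    rcases lt_or_ge x (2 ^ t) with h | h
    · rw [delta_of_lt (by omega) (by omega), hfloor]
      linear_combination ih h.le
    · rw [delta_of_le (by omega) (by omega), hfloor, hceil]
      have key := ih (x := x - 2 ^ t) (by omega)
      push_cast [h] at key
      linear_combination key

theorem two_pow_mul_delta_two_pow_sub_one {t x : ℕ} (hx₁ : 1 ≤ x) (hx : x ≤ 2 ^ t - 1) :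
    (2 : ℚ) ^ t * delta (2 ^ t - 1) x = x + 1 := by
  induction t generalizing x with
  | zero => simp at hx; omega
  | succ t ih =>
    have hpos : 0 < 2 ^ t := by positivity
    rcases Nat.eq_zero_or_pos t with rfl | ht
    · obtain rfl : x = 1 := by simp at hx; omega
      norm_num [delta]
    have htwo : 2 ≤ 2 ^ t := Nat.le_self_pow ht.ne' 2
    have hfloor : (2 ^ (t + 1) - 1) / 2 = 2 ^ t - 1 := by omega
    have hceil : (2 ^ (t + 1) - 1 + 1) / 2 = 2 ^ t := by omega
    rcases lt_or_ge x (2 ^ t - 1) with h | h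
    · rw [delta_of_lt (by omega) (by omega), hfloor]
      linear_combination ih hx₁ h.le
    · rw [delta_of_le (by omega) (by omega), hfloor, hceil]
      have key := two_pow_mul_delta_two_pow (t := t) (x := x - (2 ^ t - 1)) (by omega)
      rw [Nat.cast_sub h, Nat.cast_sub hpos] at key
      push_cast at key
      linear_combination key

theorem one_le_two_pow_mul_delta_succ_sub {k t x : ℕ} (hkt : k ≤ 2 ^ t) (hx : x < k) :
    1 ≤ (2 : ℚ) ^ t * (delta k (x + 1) - delta k x) := by
  induction t generalizing k x with
  | zero =>
    obtain rfl : k = 1 := by simp at hkt; omega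
    obtain rfl : x = 0 := by omega
    simp [delta]
  | succ t ih =>
    rcases lt_or_ge k 2 with hk | hk
    · obtain rfl : k = 1 := by omega
      obtain rfl : x = 0 := by omega
      simpa [delta] using one_le_pow₀ (one_le_two : (1 : ℚ) ≤ 2) (n := t + 1)
    rcases lt_or_ge x (k / 2) with h | h
    · have key := ih (k := k / 2) (x := x) (by omega) h
      have hsucc : delta k (x + 1) = 1 / 2 * delta (k / 2) (x + 1) := by
        rcases (Nat.succ_le_of_lt h).lt_or_eq with h' | h'
        · exact delta_of_lt hk h'
        · rw [delta_of_le hk h'.ge, ← h', Nat.sub_self, delta_zero_right,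
            delta_self (Nat.succ_pos x)]
          norm_num
      rw [hsucc, delta_of_lt hk h]
      linear_combination key
    · have key := ih (k := (k + 1) / 2) (x := x - k / 2) (by omega) (by omega)
      rw [delta_of_le hk h, delta_of_le hk (by omega), Nat.sub_add_comm h]
      linear_combination key

/-- Lemma 16 (properties of `δ_k`):
(i) `δ_k(0) = 0` and `δ_k(k) = 1` for `k ≥ 1`;
(ii) `2^t δ_{2^t}(x) = x` for `t ≥ 0` and `0 ≤ x ≤ 2^t`;
(iii) `2^t δ_{2^t - 1}(x) = x + 1` for `t ≥ 1` and `1 ≤ x ≤ 2^t - 1`;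
(iv) `2^t δ_k(x+1) - (x+1) ≥ 2^t δ_k(x) - x` for `1 ≤ k ≤ 2^t` and `0 ≤ x ≤ k - 1`. -/
theorem stmt15 :
    (∀ k : ℕ, 1 ≤ k → delta k 0 = 0 ∧ delta k k = 1) ∧
    (∀ t x : ℕ, x ≤ 2 ^ t → (2 : ℚ) ^ t * delta (2 ^ t) x = x) ∧
    (∀ t x : ℕ, 1 ≤ t → 1 ≤ x → x ≤ 2 ^ t - 1 →
      (2 : ℚ) ^ t * delta (2 ^ t - 1) x = x + 1) ∧
    (∀ k t x : ℕ, 1 ≤ k → k ≤ 2 ^ t → x ≤ k - 1 →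
      (2 : ℚ) ^ t * delta k x - x ≤ (2 : ℚ) ^ t * delta k (x + 1) - (x + 1)) := by
  refine ⟨fun k hk => ⟨delta_zero_right k, delta_self hk⟩,
    fun t x hx => two_pow_mul_delta_two_pow hx,
    fun t x _ hx₁ hx => two_pow_mul_delta_two_pow_sub_one hx₁ hx, fun k t x hk hkt hx => ?_⟩
  linear_combination one_le_two_pow_mul_delta_succ_sub hkt (show x < k by omega)
end

section
/- Let k, q and t be positive integers such that k + q = 2^t, and let ℓ ∈ {0,…,k}. Then the greatest element r of {0,…,q} satisfying 2^t·δ_q(r) − r ≤ k − ℓ is r = q − 2^t·δ_k(ℓ) + ℓ. -/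
open Finset

theorem delta_one (x : ℕ) : delta 1 x = x := by rw [delta]

theorem two_pow_succ_mul_delta_of_lt {k x : ℕ} (t : ℕ) (hk : 2 ≤ k) (hx : x < k / 2) :
    (2 : ℚ) ^ (t + 1) * delta k x = 2 ^ t * delta (k / 2) x := by
  obtain ⟨k, rfl⟩ := Nat.exists_eq_add_of_le' hk
  rw [delta, if_pos hx]
  ring

theorem two_pow_succ_mul_delta_add {k : ℕ} (t y : ℕ) (hk : 2 ≤ k) :
    (2 : ℚ) ^ (t + 1) * delta k (k / 2 + y) = 2 ^ t + 2 ^ t * delta ((k + 1) / 2) y := by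
  obtain ⟨k, rfl⟩ := Nat.exists_eq_add_of_le' hk
  rw [delta, if_neg (by omega), Nat.add_sub_cancel_left]
  ring

theorem exists_nat_eq_two_pow_mul_delta (t : ℕ) :
    ∀ k x : ℕ, 0 < k → k ≤ 2 ^ t → ∃ n : ℕ, (n : ℚ) = 2 ^ t * delta k x := by
  induction t with
  | zero =>
    intro k x hk hkt
    obtain rfl : k = 1 := by simp at hkt; omega
    exact ⟨x, by simp [delta_one]⟩
  | succ t ih =>
    intro k x hk hkt
    rw [pow_succ] at hkt
    rcases Nat.lt_or_ge k 2 with h1 | h2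
    · obtain rfl : k = 1 := by omega
      exact ⟨2 ^ (t + 1) * x, by simp [delta_one]⟩
    rcases Nat.lt_or_ge x (k / 2) with hx | hx
    · rw [two_pow_succ_mul_delta_of_lt t h2 hx]
      exact ih _ _ (by omega) (by omega)
    · obtain ⟨y, rfl⟩ := Nat.exists_eq_add_of_le hx
      obtain ⟨n, hn⟩ := ih ((k + 1) / 2) y (by omega) (by omega)
      exact ⟨2 ^ t + n, by rw [two_pow_succ_mul_delta_add t y h2, ← hn]; push_cast; rfl⟩

theorem two_pow_mul_delta_bounds (t : ℕ) :
    ∀ k x : ℕ, 0 < k → k ≤ 2 ^ t → x ≤ k →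
      (x : ℚ) ≤ 2 ^ t * delta k x ∧ 2 ^ t * delta k x + k ≤ 2 ^ t + (x : ℚ) ∧
        (k < 2 ^ t → 0 < x → (x : ℚ) < 2 ^ t * delta k x) := by
  have base : ∀ t x : ℕ, x ≤ 1 →
      (x : ℚ) ≤ 2 ^ t * delta 1 x ∧ 2 ^ t * delta 1 x + (1 : ℕ) ≤ 2 ^ t + (x : ℚ) ∧
        (1 < 2 ^ t → 0 < x → (x : ℚ) < 2 ^ t * delta 1 x) := by
    intro t x hx
    have h : (1 : ℚ) ≤ 2 ^ t := one_le_pow₀ (by norm_num)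
    rw [delta_one]
    interval_cases x
    · simpa using h
    · refine ⟨by simpa using h, by simp, fun h' _ => ?_⟩
      have : (1 : ℚ) < 2 ^ t := by exact_mod_cast h'
      simpa using this
  induction t with
  | zero =>
    intro k x hk hkt hx
    obtain rfl : k = 1 := by simp at hkt; omega
    exact base 0 x hx
  | succ t ih =>
    intro k x hk hkt hx
    rcases Nat.lt_or_ge k 2 with h1 | h2
    · obtain rfl : k = 1 := by omega
      exact base _ x hx
    have hpow : (2 : ℚ) ^ (t + 1) = 2 ^ t + 2 ^ t := by ring
    have hk2 : (k : ℚ) = (k / 2 : ℕ) + ((k + 1) / 2 : ℕ) := by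
      exact_mod_cast (by omega : k = k / 2 + (k + 1) / 2)
    rw [pow_succ] at hkt
    have hle1 : ((k / 2 : ℕ) : ℚ) ≤ 2 ^ t := by exact_mod_cast (by omega : k / 2 ≤ 2 ^ t)
    have hle2 : (((k + 1) / 2 : ℕ) : ℚ) ≤ 2 ^ t := by
      exact_mod_cast (by omega : (k + 1) / 2 ≤ 2 ^ t)
    rcases Nat.lt_or_ge x (k / 2) with hxk | hxk
    · obtain ⟨hl, hu, hs⟩ := ih (k / 2) x (by omega) (by omega) hxk.le
      rw [two_pow_succ_mul_delta_of_lt t h2 hxk]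
      refine ⟨hl, by linarith, fun h h0 => hs ?_ h0⟩
      rw [pow_succ] at h
      omega
    · obtain ⟨y, rfl⟩ := Nat.exists_eq_add_of_le hxk
      obtain ⟨hl, hu, -⟩ := ih ((k + 1) / 2) y (by omega) (by omega) (by omega)
      rw [two_pow_succ_mul_delta_add t y h2]
      push_cast
      refine ⟨by linarith, by linarith, fun h _ => ?_⟩
      rw [pow_succ] at h
      have : ((k / 2 : ℕ) : ℚ) < 2 ^ t := by exact_mod_cast (by omega : k / 2 < 2 ^ t)
      linarith

theorem two_pow_mul_delta_add_le_iff_of_one {q t ℓ r : ℕ} (hq : 0 < q) (hsum : 1 + q = 2 ^ t)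
    (hℓ : ℓ ≤ 1) (hr : r ≤ q) :
    2 ^ t * delta q r + ℓ ≤ (1 : ℕ) + (r : ℚ) ↔ 2 ^ t * delta 1 ℓ + r ≤ q + (ℓ : ℚ) := by
  obtain ⟨-, hu, hs⟩ := two_pow_mul_delta_bounds t q r hq (by omega) hr
  have hsumQ : (1 : ℚ) + q = 2 ^ t := by exact_mod_cast hsum
  have hrQ : (r : ℚ) ≤ q := by exact_mod_cast hr
  rw [delta_one]
  interval_cases ℓ
  · simp only [Nat.cast_zero, Nat.cast_one]
    constructor <;> intro <;> linarith
  · rcases Nat.eq_zero_or_pos r with rfl | hr0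
    · simp [delta_zero_right]
      linarith
    · have hlt := hs (by omega) hr0
      have hr0Q : (0 : ℚ) < r := by exact_mod_cast hr0
      simp only [Nat.cast_one]
      constructor <;> intro <;> linarith

/-- Duality between `δ_k` and `δ_q` when `k + q = 2 ^ t`. -/
theorem two_pow_mul_delta_add_le_iff (t : ℕ) :
    ∀ k q ℓ r : ℕ, 0 < k → 0 < q → k + q = 2 ^ t → ℓ ≤ k → r ≤ q →
      (2 ^ t * delta q r + ℓ ≤ k + (r : ℚ) ↔ 2 ^ t * delta k ℓ + r ≤ q + (ℓ : ℚ)) := by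
  induction t with
  | zero => intro k q ℓ r hk hq hsum; simp at hsum; omega
  | succ t ih =>
    intro k q ℓ r hk hq hsum hℓ hr
    rcases Nat.lt_or_ge k 2 with h1 | hk2
    · obtain rfl : k = 1 := by omega
      exact two_pow_mul_delta_add_le_iff_of_one hq hsum hℓ hr
    rcases Nat.lt_or_ge q 2 with h1 | hq2
    · obtain rfl : q = 1 := by omega
      exact (two_pow_mul_delta_add_le_iff_of_one hk (by omega) hr hℓ).symm
    rw [pow_succ] at hsum
    obtain ⟨k₁, hk₁⟩ : ∃ n, n = k / 2 := ⟨_, rfl⟩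
    obtain ⟨k₂, hk₂⟩ : ∃ n, n = (k + 1) / 2 := ⟨_, rfl⟩
    obtain ⟨q₁, hq₁⟩ : ∃ n, n = q / 2 := ⟨_, rfl⟩
    obtain ⟨q₂, hq₂⟩ : ∃ n, n = (q + 1) / 2 := ⟨_, rfl⟩
    have hkQ : (k : ℚ) = k₁ + k₂ := by exact_mod_cast (by omega : k = k₁ + k₂)
    have hqQ : (q : ℚ) = q₁ + q₂ := by exact_mod_cast (by omega : q = q₁ + q₂)
    have h12 : k₁ + q₂ = 2 ^ t := by omega
    have h21 : k₂ + q₁ = 2 ^ t := by omega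
    have h12Q : (k₁ : ℚ) + q₂ = 2 ^ t := by exact_mod_cast h12
    have h21Q : (k₂ : ℚ) + q₁ = 2 ^ t := by exact_mod_cast h21
    have hqk : (0 : ℚ) ≤ q₂ ∧ (0 : ℚ) ≤ k₂ := ⟨by positivity, by positivity⟩
    rcases Nat.lt_or_ge ℓ (k / 2) with hℓk | hℓk <;> rcases Nat.lt_or_ge r (q / 2) with hrq | hrq
    · rw [two_pow_succ_mul_delta_of_lt t hk2 hℓk, two_pow_succ_mul_delta_of_lt t hq2 hrq, ← hk₁,
        ← hq₁]
      obtain ⟨-, hu, -⟩ := two_pow_mul_delta_bounds t q₁ r (by omega) (by omega) (by omega)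
      obtain ⟨-, hu', -⟩ := two_pow_mul_delta_bounds t k₁ ℓ (by omega) (by omega) (by omega)
      have hℓQ : (ℓ : ℚ) ≤ k₁ := by exact_mod_cast (by omega : ℓ ≤ k₁)
      have hrQ : (r : ℚ) ≤ q₁ := by exact_mod_cast (by omega : r ≤ q₁)
      constructor <;> intro <;> linarith
    · obtain ⟨s, rfl⟩ := Nat.exists_eq_add_of_le hrq
      have := ih k₁ q₂ ℓ s (by omega) (by omega) h12 (by omega) (by omega)
      rw [two_pow_succ_mul_delta_of_lt t hk2 hℓk, two_pow_succ_mul_delta_add t s hq2, ← hk₁,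
        ← hq₁, ← hq₂, Nat.cast_add]
      constructor
      · intro h; linarith [this.1 (by linarith)]
      · intro h; linarith [this.2 (by linarith)]
    · obtain ⟨m, rfl⟩ := Nat.exists_eq_add_of_le hℓk
      have := ih k₂ q₁ m r (by omega) (by omega) h21 (by omega) (by omega)
      rw [two_pow_succ_mul_delta_add t m hk2, two_pow_succ_mul_delta_of_lt t hq2 hrq, ← hk₁,
        ← hk₂, ← hq₁, Nat.cast_add]
      constructor
      · intro h; linarith [this.1 (by linarith)]
      · intro h; linarith [this.2 (by linarith)]
    · obtain ⟨m, rfl⟩ := Nat.exists_eq_add_of_le hℓk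
      obtain ⟨s, rfl⟩ := Nat.exists_eq_add_of_le hrq
      rw [two_pow_succ_mul_delta_add t m hk2, two_pow_succ_mul_delta_add t s hq2, ← hk₁,
        ← hk₂, ← hq₁, ← hq₂, Nat.cast_add, Nat.cast_add]
      obtain ⟨hl, -, hs⟩ := two_pow_mul_delta_bounds t q₂ s (by omega) (by omega) (by omega)
      obtain ⟨hl', -, hs'⟩ := two_pow_mul_delta_bounds t k₂ m (by omega) (by omega) (by omega)
      have hmQ : (0 : ℚ) ≤ m := by positivity
      have hsQ : (0 : ℚ) ≤ s := by positivity
      rcases Nat.eq_zero_or_pos m with rfl | hm <;> rcases Nat.eq_zero_or_pos s with rfl | hs0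
      · simp only [delta_zero_right, Nat.cast_zero]
        constructor <;> intro <;> linarith
      · have := hs (by omega) hs0
        have : (0 : ℚ) < s := by exact_mod_cast hs0
        constructor <;> intro <;> linarith
      · have := hs' (by omega) hm
        have : (0 : ℚ) < m := by exact_mod_cast hm
        constructor <;> intro <;> linarith
      · have : (0 : ℚ) < m := by exact_mod_cast hm
        have : (0 : ℚ) < s := by exact_mod_cast hs0
        constructor <;> intro <;> linarith

/-- Lemma 17: for positive integers `k, q, t` with `k + q = 2^t` and `ℓ ∈ {0,…,k}`,
the greatest element `r` of `{0,…,q}` with `2^t δ_q(r) - r ≤ k - ℓ` is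
`r = q - 2^t δ_k(ℓ) + ℓ`. -/
theorem stmt16 (k q t : ℕ) (hk : 0 < k) (hq : 0 < q) (ht : 0 < t)
    (hsum : k + q = 2 ^ t) (ℓ : ℕ) (hℓ : ℓ ≤ k) :
    ∃ r : ℕ,
      IsGreatest {r' : ℕ | r' ≤ q ∧ (2 : ℚ) ^ t * delta q r' - r' ≤ (k : ℚ) - ℓ} r ∧
      (r : ℚ) = (q : ℚ) - 2 ^ t * delta k ℓ + ℓ := by
  obtain ⟨n, hn⟩ := exists_nat_eq_two_pow_mul_delta t k ℓ hk (by omega)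
  obtain ⟨hl, hu, -⟩ := two_pow_mul_delta_bounds t k ℓ hk (by omega) hℓ
  have hsumQ : (k : ℚ) + q = 2 ^ t := by exact_mod_cast hsum
  rw [← hn] at hl hu
  have hln : ℓ ≤ n := by exact_mod_cast hl
  have hnq : n ≤ q + ℓ := by
    have : (n : ℚ) ≤ q + ℓ := by linarith
    exact_mod_cast this
  have hr : ((q + ℓ - n : ℕ) : ℚ) = q - 2 ^ t * delta k ℓ + ℓ := by
    rw [← hn, Nat.cast_sub hnq]
    push_cast
    ring
  refine ⟨q + ℓ - n, ⟨⟨by omega, ?_⟩, ?_⟩, hr⟩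
  · have := (two_pow_mul_delta_add_le_iff t k q ℓ (q + ℓ - n) hk hq hsum hℓ (by omega)).2
      (by linarith)
    linarith
  · rintro r' ⟨hr'q, hr'⟩
    have := (two_pow_mul_delta_add_le_iff t k q ℓ r' hk hq hsum hℓ hr'q).1 (by linarith)
    have : (r' : ℚ) ≤ ((q + ℓ - n : ℕ) : ℚ) := by linarith
    exact_mod_cast this
end

section
/- Let n ≥ 2 and let 𝓕_ℓ be a family of subsets of [n] with |𝓕_ℓ| = ℓ and |(𝓕_ℓ)↕| = Φ(n,ℓ), where ℓ < 2^{n−2}. Then 𝓕*_ℓ is a convex family with |𝓕*_ℓ| = ℓ* and |(𝓕*_ℓ)↕| = Φ(n,ℓ*), and Φ(n,m) = 2^n − ℓ for each m ∈ {(ℓ+1)* + 1, …, ℓ*}. -/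
open Finset

/-- A family is convex (w.r.t. ground set `X`) if `𝓕↑ ∩ 𝓕↓ = 𝓕`. -/
def IsConvex (X : Finset ℕ) (F : Finset (Finset ℕ)) : Prop :=
  upClo X F ∩ downClo X F = F

/-- The reversing permutation `ρ(x) = n + 1 - x` of `[n]` applied to a set. -/
def rev (n : ℕ) (A : Finset ℕ) : Finset ℕ := A.image (fun x => n + 1 - x)

/-- The reverse `ρ(𝓕)` of a family. -/
def revFam (n : ℕ) (F : Finset (Finset ℕ)) : Finset (Finset ℕ) := F.image (rev n)

/-- The conjugate `𝓕* = 2^[n] ∖ (ρ(𝓕))↕` of a family `𝓕`. -/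
def conjFam (n : ℕ) (F : Finset (Finset ℕ)) : Finset (Finset ℕ) :=
  (groundSet n).powerset \ udClo (groundSet n) (revFam n F)

/-- Size of the intersection of the first `a` subsets of an `n`-set in lexicographic order with the
first `b` subsets in the opposite order, the optimum for up-sets of size `a` and down-sets of
size `b`. -/
def maxInter : ℕ → ℕ → ℕ → ℕ
  | 0, a, b => min a b
  | n + 1, a, b =>
    if a ≤ 2 ^ n then maxInter n a (b / 2)
    else b / 2 + maxInter n (a - 2 ^ n) ((b + 1) / 2)

theorem maxInter_of_le {n a : ℕ} (b : ℕ) (h : a ≤ 2 ^ n) :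
    maxInter (n + 1) a b = maxInter n a (b / 2) := by
  simp [maxInter, h]

theorem maxInter_of_lt {n a : ℕ} (b : ℕ) (h : 2 ^ n < a) :
    maxInter (n + 1) a b = b / 2 + maxInter n (a - 2 ^ n) ((b + 1) / 2) := by
  simp [maxInter, Nat.not_le.2 h]

theorem maxInter_zero_right (n a : ℕ) (ha : a ≤ 2 ^ n) : maxInter n a 0 = 0 := by
  induction n generalizing a with
  | zero => simp [maxInter]
  | succ n ih =>
    rcases le_or_gt a (2 ^ n) with h | h
    · rw [maxInter_of_le _ h]; exact ih _ h
    · rw [maxInter_of_lt _ h]; simpa using ih _ (by rw [pow_succ] at ha; omega)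

theorem maxInter_two_pow_left (n b : ℕ) (hb : b ≤ 2 ^ n) : maxInter n (2 ^ n) b = b := by
  induction n generalizing b with
  | zero => simpa [maxInter] using hb
  | succ n ih =>
    have hpow : 2 ^ (n + 1) = 2 ^ n + 2 ^ n := by rw [pow_succ]; omega
    have hpos : 0 < 2 ^ n := by positivity
    rw [maxInter_of_lt _ (by omega), show 2 ^ (n + 1) - 2 ^ n = 2 ^ n by omega, ih _ (by omega)]
    omega

theorem maxInter_succ_right (n a b : ℕ) :
    maxInter n a b ≤ maxInter n a (b + 1) ∧ maxInter n a (b + 1) ≤ maxInter n a b + 1 := by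
  induction n generalizing a b with
  | zero => simp only [maxInter]; omega
  | succ n ih =>
    rcases Nat.even_or_odd' b with ⟨c, rfl | rfl⟩ <;> rcases le_or_gt a (2 ^ n) with h | h
    · rw [maxInter_of_le _ h, maxInter_of_le _ h,
        show (2 * c + 1) / 2 = c by omega, show 2 * c / 2 = c by omega]
      omega
    · rw [maxInter_of_lt _ h, maxInter_of_lt _ h,
        show (2 * c + 1) / 2 = c by omega, show 2 * c / 2 = c by omega,
        show (2 * c + 1 + 1) / 2 = c + 1 by omega]
      have := ih (a - 2 ^ n) c
      omega
    · rw [maxInter_of_le _ h, maxInter_of_le _ h,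
        show (2 * c + 1) / 2 = c by omega, show (2 * c + 1 + 1) / 2 = c + 1 by omega]
      exact ih a c
    · rw [maxInter_of_lt _ h, maxInter_of_lt _ h,
        show (2 * c + 1) / 2 = c by omega, show (2 * c + 1 + 1) / 2 = c + 1 by omega,
        show (2 * c + 1 + 1 + 1) / 2 = c + 1 by omega]
      omega

theorem maxInter_mono_right (n a : ℕ) {b c : ℕ} (h : b ≤ c) :
    maxInter n a b ≤ maxInter n a c :=
  monotone_nat_of_le_succ (fun b => (maxInter_succ_right n a b).1) h

theorem maxInter_le_add_sub (n a b c : ℕ) : maxInter n a c ≤ maxInter n a b + (c - b) := by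
  rcases le_total c b with h | h
  · exact (maxInter_mono_right n a h).trans (Nat.le_add_right _ _)
  · obtain ⟨d, rfl⟩ := Nat.exists_eq_add_of_le h
    rw [Nat.add_sub_cancel_left]
    clear h
    induction d with
    | zero => simp
    | succ d ih => have := (maxInter_succ_right n a (b + d)).2; rw [← add_assoc]; omega

theorem maxInter_superadditive (n : ℕ) : ∀ p q t : ℕ, p ≤ 2 ^ n → q ≤ 2 ^ n →
    (p + q ≤ 2 ^ n → maxInter n p t + maxInter n q t ≤ maxInter n (p + q) t) ∧
    (2 ^ n ≤ p + q → maxInter n p t + maxInter n q t ≤ t + maxInter n (p + q - 2 ^ n) t) := by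
  induction n with
  | zero => intro p q t hp hq; simp only [maxInter, pow_zero] at *; omega
  | succ n ih =>
    intro p q t hp hq
    wlog hpq : p ≤ q generalizing p q
    · have := this q p hq hp (le_of_not_ge hpq)
      rwa [add_comm q p, add_comm (maxInter (n + 1) q t)] at this
    have hpow : 2 ^ (n + 1) = 2 ^ n + 2 ^ n := by rw [pow_succ]; omega
    rw [hpow] at hp hq ⊢
    generalize hg : 2 ^ n = g at *
    have hmono : ∀ a, maxInter n a (t / 2) ≤ maxInter n a ((t + 1) / 2) :=
      fun a => maxInter_mono_right n a (by omega)
    have hlip : ∀ a, maxInter n a ((t + 1) / 2) ≤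
        maxInter n a (t / 2) + ((t + 1) / 2 - t / 2) :=
      fun a => maxInter_le_add_sub n a _ _
    have low : ∀ a, a ≤ g → maxInter (n + 1) a t = maxInter n a (t / 2) :=
      fun a ha => maxInter_of_le _ (by omega)
    have high : ∀ a, g < a →
        maxInter (n + 1) a t = t / 2 + maxInter n (a - g) ((t + 1) / 2) := by
      intro a ha; rw [maxInter_of_lt _ (by omega), hg]
    constructor
    · intro hs
      rw [low p (by omega)]
      rcases le_or_gt q g with h | h
      · rw [low q h]
        have h1 := ih p q (t / 2) (by omega) h
        rcases le_or_gt (p + q) g with h2 | h2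
        · rw [low _ h2]; exact h1.1 h2
        · rw [high _ h2]
          have := h1.2 h2.le
          have := hmono (p + q - g)
          omega
      · rw [high q h, high (p + q) (by omega)]
        have h1 := (ih p (q - g) ((t + 1) / 2) (by omega) (by omega)).1 (by omega)
        rw [show p + (q - g) = p + q - g by omega] at h1
        have := hmono p
        omega
    · intro hs
      rcases le_or_gt p g with h | h
      · rw [low p h, low (p + q - (g + g)) (by omega)]
        rcases le_or_gt q g with hq' | hq'
        · rw [low q hq']
          have h1 := (ih p q (t / 2) h hq').2 (by omega)
          have h2 := (ih (p + q - g) 0 (t / 2) (by omega) (by omega)).2 (by omega)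
          simp only [add_zero] at h2
          rw [show p + q - g - g = p + q - (g + g) by omega] at h2
          have h3 := maxInter_le_add_sub n (p + q - g) 0 (t / 2)
          rw [maxInter_zero_right n _ (by omega)] at h3
          omega
        · rw [high q hq']
          have h1 := (ih p (q - g) (t / 2) h (by omega)).2 (by omega)
          rw [show p + (q - g) - g = p + q - (g + g) by omega] at h1
          have := hlip (q - g)
          omega
      · rw [high p h, high q (by omega)]
        have h1 := ih (p - g) (q - g) ((t + 1) / 2) (by omega) (by omega)
        rw [show p - g + (q - g) = p + q - (g + g) by omega] at h1
        rcases le_or_gt (p + q - (g + g)) g with h2 | h2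
        · rw [low _ h2]
          have := h1.1 h2
          have := hlip (p + q - (g + g))
          omega
        · rw [high _ h2]
          have := h1.2 h2.le
          omega

theorem maxInter_add_le (n : ℕ) : ∀ a₀ a₁ b₀ b₁ : ℕ, a₀ ≤ a₁ → a₁ ≤ 2 ^ n → b₁ ≤ b₀ →
    maxInter n a₀ b₀ + maxInter n a₁ b₁ ≤ maxInter (n + 1) (a₀ + a₁) (b₀ + b₁) := by
  induction n with
  | zero =>
    intro a₀ a₁ b₀ b₁ ha ha₁ hb
    rw [maxInter.eq_2]
    split_ifs <;> simp only [maxInter, pow_zero] at * <;> omega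
  | succ n ih =>
    intro a₀ a₁ b₀ b₁ ha ha₁ hb
    have hpow : 2 ^ (n + 1) = 2 ^ n + 2 ^ n := by rw [pow_succ]; omega
    have sup := maxInter_superadditive n
    have low : ∀ a b, a ≤ 2 ^ n → maxInter (n + 1) a b = maxInter n a (b / 2) :=
      fun a b h => maxInter_of_le b h
    have high : ∀ a b, 2 ^ n < a →
        maxInter (n + 1) a b = b / 2 + maxInter n (a - 2 ^ n) ((b + 1) / 2) :=
      fun a b h => maxInter_of_lt b h
    have outer : (a₀ + a₁ ≤ 2 ^ n + 2 ^ n ∧ maxInter (n + 1 + 1) (a₀ + a₁) (b₀ + b₁) =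
          maxInter (n + 1) (a₀ + a₁) ((b₀ + b₁) / 2)) ∨
        (2 ^ n + 2 ^ n < a₀ + a₁ ∧ maxInter (n + 1 + 1) (a₀ + a₁) (b₀ + b₁) =
          (b₀ + b₁) / 2 +
            maxInter (n + 1) (a₀ + a₁ - (2 ^ n + 2 ^ n)) ((b₀ + b₁ + 1) / 2)) := by
      rcases le_or_gt (a₀ + a₁) (2 ^ (n + 1)) with h | h
      · exact Or.inl ⟨by omega, maxInter_of_le _ h⟩
      · exact Or.inr ⟨by omega, by rw [maxInter_of_lt _ h, hpow]⟩
    rw [hpow] at ha₁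
    have lip := maxInter_le_add_sub n
    generalize 2 ^ n = g at *
    rcases outer with ⟨hs, hout⟩ | ⟨hs, hout⟩ <;> rw [hout]
    · rw [low a₀ _ (by omega)]
      rcases le_or_gt a₁ g with h | h
      · rw [low a₁ _ h]
        refine (ih a₀ a₁ (b₀ / 2) (b₁ / 2) ha h (by omega)).trans ?_
        exact maxInter_mono_right _ _ (by omega)
      · rw [high a₁ _ h, high (a₀ + a₁) _ (by omega)]
        have h1 := (sup a₀ (a₁ - g) (((b₀ + b₁) / 2 + 1) / 2) (by omega) (by omega)).1 (by omega)
        rw [show a₀ + (a₁ - g) = a₀ + a₁ - g by omega] at h1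
        have h2 := lip a₀ (((b₀ + b₁) / 2 + 1) / 2) (b₀ / 2)
        have h3 := lip (a₁ - g) (((b₀ + b₁) / 2 + 1) / 2) ((b₁ + 1) / 2)
        omega
    · rw [high a₁ _ (by omega)]
      rcases le_or_gt a₀ g with h | h
      · rw [low a₀ _ h, low (a₀ + a₁ - (g + g)) _ (by omega)]
        have h1 := (sup a₀ (a₁ - g) ((b₀ + b₁ + 1) / 2 / 2) h (by omega)).2 (by omega)
        rw [show a₀ + (a₁ - g) - g = a₀ + a₁ - (g + g) by omega] at h1
        have h2 := lip a₀ ((b₀ + b₁ + 1) / 2 / 2) (b₀ / 2)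
        have h3 := lip (a₁ - g) ((b₀ + b₁ + 1) / 2 / 2) ((b₁ + 1) / 2)
        omega
      · rw [high a₀ _ h]
        have h1 := ih (a₀ - g) (a₁ - g) ((b₀ + 1) / 2) ((b₁ + 1) / 2) (by omega) (by omega)
          (by omega)
        rw [show a₀ - g + (a₁ - g) = a₀ + a₁ - (g + g) by omega] at h1
        have h2 := maxInter_le_add_sub (n + 1) (a₀ + a₁ - (g + g)) ((b₀ + b₁ + 1) / 2)
          ((b₀ + 1) / 2 + (b₁ + 1) / 2)
        omega

/-- A family of subsets of `X` closed under taking supersets inside `X`. -/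
def IsUpFam (X : Finset ℕ) (U : Finset (Finset ℕ)) : Prop :=
  U ⊆ X.powerset ∧ ∀ S ∈ U, ∀ T, S ⊆ T → T ⊆ X → T ∈ U

/-- A family of subsets of `X` closed under taking subsets. -/
def IsDownFam (X : Finset ℕ) (D : Finset (Finset ℕ)) : Prop :=
  D ⊆ X.powerset ∧ ∀ S ∈ D, ∀ T, T ⊆ S → T ∈ D

/-- The family with sections `A` (sets avoiding `x`) and `B` (sets containing `x`). -/
def glue (x : ℕ) (A B : Finset (Finset ℕ)) : Finset (Finset ℕ) := A ∪ B.image (insert x)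

section Sections

variable {x : ℕ} {Y : Finset ℕ} {A B C D U : Finset (Finset ℕ)}

theorem subset_of_mem_family (hA : A ⊆ Y.powerset) {S : Finset ℕ} (hS : S ∈ A) : S ⊆ Y :=
  mem_powerset.1 (hA hS)

theorem mem_glue (hx : x ∉ Y) (hA : A ⊆ Y.powerset) (hB : B ⊆ Y.powerset) {S : Finset ℕ} :
    S ∈ glue x A B ↔ (x ∉ S ∧ S ∈ A) ∨ (x ∈ S ∧ S.erase x ∈ B) := by
  simp only [glue, mem_union, mem_image]
  constructor
  · rintro (h | ⟨T, hT, rfl⟩)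
    · exact Or.inl ⟨fun h' => hx (subset_of_mem_family hA h h'), h⟩
    · have : x ∉ T := fun h' => hx (subset_of_mem_family hB hT h')
      exact Or.inr ⟨mem_insert_self _ _, by rwa [erase_insert this]⟩
  · rintro (⟨-, h⟩ | ⟨h, h'⟩)
    · exact Or.inl h
    · exact Or.inr ⟨_, h', insert_erase h⟩

theorem glue_subset (hA : A ⊆ Y.powerset) (hB : B ⊆ Y.powerset) :
    glue x A B ⊆ (insert x Y).powerset := by
  rw [powerset_insert]
  exact union_subset_union hA (image_subset_image hB)

theorem card_glue (hx : x ∉ Y) (hA : A ⊆ Y.powerset) (hB : B ⊆ Y.powerset) :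
    (glue x A B).card = A.card + B.card := by
  rw [glue, card_union_of_disjoint, card_image_of_injOn]
  · intro S hS T hT h
    have h1 : x ∉ S := fun h' => hx (subset_of_mem_family hB hS h')
    have h2 : x ∉ T := fun h' => hx (subset_of_mem_family hB hT h')
    rw [← erase_insert h1, ← erase_insert h2]
    exact congrArg (fun R : Finset ℕ => R.erase x) h
  · rw [Finset.disjoint_left]
    intro S hS hS'
    obtain ⟨T, -, rfl⟩ := mem_image.1 hS'
    exact hx (subset_of_mem_family hA hS (mem_insert_self _ _))

theorem glue_inter_glue (hx : x ∉ Y) (hA : A ⊆ Y.powerset) (hB : B ⊆ Y.powerset)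
    (hC : C ⊆ Y.powerset) (hD : D ⊆ Y.powerset) :
    glue x A B ∩ glue x C D = glue x (A ∩ C) (B ∩ D) := by
  ext S
  rw [mem_inter, mem_glue hx hA hB, mem_glue hx hC hD,
    mem_glue hx (inter_subset_left.trans hA) (inter_subset_left.trans hB), mem_inter, mem_inter]
  tauto

theorem IsUpFam.glue (hx : x ∉ Y) (hA : IsUpFam Y A) (hB : IsUpFam Y B) (hAB : A ⊆ B) :
    IsUpFam (insert x Y) (glue x A B) := by
  refine ⟨glue_subset hA.1 hB.1, fun S hS T hST hT => ?_⟩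
  rw [mem_glue hx hA.1 hB.1] at hS ⊢
  have hT' : T.erase x ⊆ Y := by rwa [← subset_insert_iff]
  rcases hS with ⟨h, hS⟩ | ⟨h, hS⟩
  · by_cases hxT : x ∈ T
    · exact Or.inr ⟨hxT, hB.2 S (hAB hS) _ (subset_erase.2 ⟨hST, h⟩) hT'⟩
    · exact Or.inl ⟨hxT, hA.2 S hS _ hST (by rwa [erase_eq_of_notMem hxT] at hT')⟩
  · exact Or.inr ⟨hST h, hB.2 _ hS _ (erase_subset_erase _ hST) hT'⟩

theorem IsDownFam.glue (hx : x ∉ Y) (hA : IsDownFam Y A) (hB : IsDownFam Y B) (hBA : B ⊆ A) :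
    IsDownFam (insert x Y) (glue x A B) := by
  refine ⟨glue_subset hA.1 hB.1, fun S hS T hST => ?_⟩
  rw [mem_glue hx hA.1 hB.1] at hS ⊢
  rcases hS with ⟨h, hS⟩ | ⟨h, hS⟩
  · exact Or.inl ⟨fun h' => h (hST h'), hA.2 S hS _ hST⟩
  · by_cases hxT : x ∈ T
    · exact Or.inr ⟨hxT, hB.2 _ hS _ (erase_subset_erase _ hST)⟩
    · exact Or.inl ⟨hxT, hA.2 _ (hBA hS) _ (subset_erase.2 ⟨hST, hxT⟩)⟩

theorem IsUpFam.sections (hx : x ∉ Y) (hU : IsUpFam (insert x Y) U) :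
    IsUpFam Y (U.nonMemberSubfamily x) ∧ IsUpFam Y (U.memberSubfamily x) ∧
      U.nonMemberSubfamily x ⊆ U.memberSubfamily x := by
  have hsub : ∀ S ∈ U, S ⊆ insert x Y := fun S hS => subset_of_mem_family hU.1 hS
  refine ⟨⟨fun S hS => ?_, fun S hS T hST hT => ?_⟩, ⟨fun S hS => ?_, fun S hS T hST hT => ?_⟩,
    fun S hS => ?_⟩ <;>
  simp only [mem_nonMemberSubfamily, mem_memberSubfamily, mem_powerset] at hS ⊢
  · exact (subset_insert_iff_of_notMem hS.2).1 (hsub _ hS.1)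
  · exact ⟨hU.2 _ hS.1 _ hST (hT.trans (subset_insert _ _)), fun h => hx (hT h)⟩
  · exact (subset_insert_iff_of_notMem hS.2).1 ((subset_insert _ _).trans (hsub _ hS.1))
  · exact ⟨hU.2 _ hS.1 _ (insert_subset_insert _ hST) (insert_subset_insert _ hT),
      fun h => hx (hT h)⟩
  · exact ⟨hU.2 _ hS.1 _ (subset_insert _ _)
      (insert_subset (mem_insert_self _ _) (hsub _ hS.1)), hS.2⟩

theorem IsDownFam.sections (hD : IsDownFam (insert x Y) D) :
    IsDownFam Y (D.nonMemberSubfamily x) ∧ IsDownFam Y (D.memberSubfamily x) ∧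
      D.memberSubfamily x ⊆ D.nonMemberSubfamily x := by
  have hsub : ∀ S ∈ D, S ⊆ insert x Y := fun S hS => subset_of_mem_family hD.1 hS
  refine ⟨⟨fun S hS => ?_, fun S hS T hST => ?_⟩, ⟨fun S hS => ?_, fun S hS T hST => ?_⟩,
    fun S hS => ?_⟩ <;>
  simp only [mem_nonMemberSubfamily, mem_memberSubfamily, mem_powerset] at hS ⊢
  · exact (subset_insert_iff_of_notMem hS.2).1 (hsub _ hS.1)
  · exact ⟨hD.2 _ hS.1 _ hST, fun h => hS.2 (hST h)⟩
  · exact (subset_insert_iff_of_notMem hS.2).1 ((subset_insert _ _).trans (hsub _ hS.1))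
  · exact ⟨hD.2 _ hS.1 _ (insert_subset_insert _ hST), fun h => hS.2 (hST h)⟩
  · exact ⟨hD.2 _ hS.1 _ (subset_insert _ _), hS.2⟩

end Sections

theorem card_inter_le_maxInter (X : Finset ℕ) : ∀ U D : Finset (Finset ℕ),
    IsUpFam X U → IsDownFam X D → (U ∩ D).card ≤ maxInter X.card U.card D.card := by
  induction X using Finset.induction with
  | empty =>
    intro U D _ _
    exact le_min (card_le_card inter_subset_left) (card_le_card inter_subset_right)
  | insert x Y hx ih =>
    intro U D hU hD
    obtain ⟨hU0, hU1, hU01⟩ := hU.sections hx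
    obtain ⟨hD0, hD1, hD10⟩ := hD.sections
    rw [card_insert_of_notMem hx, ← card_memberSubfamily_add_card_nonMemberSubfamily x (U ∩ D),
      ← card_memberSubfamily_add_card_nonMemberSubfamily x U,
      ← card_memberSubfamily_add_card_nonMemberSubfamily x D,
      memberSubfamily_inter, nonMemberSubfamily_inter,
      add_comm (U.memberSubfamily x ∩ D.memberSubfamily x).card,
      add_comm (U.memberSubfamily x).card, add_comm (D.memberSubfamily x).card]
    refine (add_le_add (ih _ _ hU0 hD0) (ih _ _ hU1 hD1)).trans
      (maxInter_add_le _ _ _ _ _ (card_le_card hU01) ?_ (card_le_card hD10))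
    simpa using card_le_card hU1.1

theorem IsDownFam.exists_card_succ {X : Finset ℕ} {D : Finset (Finset ℕ)} (hD : IsDownFam X D)
    (h : D.card < 2 ^ X.card) : ∃ E, IsDownFam X E ∧ D ⊆ E ∧ E.card = D.card + 1 := by
  obtain ⟨S, hS⟩ : (X.powerset \ D).Nonempty := by
    rw [← card_pos, card_sdiff_of_subset hD.1, card_powerset]; omega
  obtain ⟨T, -, hT⟩ := (X.powerset \ D).exists_le_minimal hS
  obtain ⟨hTX, hTD⟩ := mem_sdiff.1 hT.1
  refine ⟨insert T D, ⟨insert_subset hTX hD.1, fun S hS R hR => ?_⟩, subset_insert _ _,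
    card_insert_of_notMem hTD⟩
  rcases mem_insert.1 hS with rfl | hS
  · by_contra hRD
    rw [mem_insert, not_or] at hRD
    exact hRD.1 (hT.eq_of_le
      (mem_sdiff.2 ⟨mem_powerset.2 (hR.trans (mem_powerset.1 hTX)), hRD.2⟩) hR)
  · exact mem_insert_of_mem (hD.2 S hS R hR)

theorem IsDownFam.exists_card_add_one_eq {X : Finset ℕ} {D : Finset (Finset ℕ)}
    (hD : IsDownFam X D) (h : 0 < D.card) :
    ∃ E, IsDownFam X E ∧ E ⊆ D ∧ E.card + 1 = D.card := by
  obtain ⟨S, hS⟩ := card_pos.1 h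
  obtain ⟨T, -, hT⟩ := D.exists_le_maximal hS
  refine ⟨D.erase T, ⟨(erase_subset _ _).trans hD.1, fun S hS R hR => ?_⟩, erase_subset _ _,
    card_erase_add_one hT.1⟩
  rw [mem_erase] at hS ⊢
  refine ⟨?_, hD.2 S hS.2 R hR⟩
  rintro rfl
  exact hS.1 (hT.eq_of_le hS.2 hR).symm

theorem exists_maxInter_le_card_inter (X : Finset ℕ) : ∀ a b : ℕ, a ≤ 2 ^ X.card →
    b ≤ 2 ^ X.card → ∃ U D, IsUpFam X U ∧ IsDownFam X D ∧ U.card = a ∧ D.card = b ∧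
      maxInter X.card a b ≤ (U ∩ D).card := by
  induction X using Finset.induction with
  | empty =>
    have key : ∀ a, a ≤ 1 → ∃ U : Finset (Finset ℕ), U ⊆ {∅} ∧ U.card = a := fun a ha =>
      exists_subset_card_eq (by simpa using ha)
    have hup : ∀ U : Finset (Finset ℕ), U ⊆ {∅} → IsUpFam ∅ U := fun U hU =>
      ⟨by simpa using hU, fun S hS T _ hT => by
        rw [subset_empty.1 hT]; rwa [← mem_singleton.1 (hU hS)]⟩
    have hdown : ∀ U : Finset (Finset ℕ), U ⊆ {∅} → IsDownFam ∅ U := fun U hU =>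
      ⟨by simpa using hU, fun S hS T hT => by
        have := mem_singleton.1 (hU hS)
        subst this
        rwa [subset_empty.1 hT]⟩
    intro a b ha hb
    simp only [card_empty, pow_zero] at ha hb ⊢
    obtain ⟨U, hU, rfl⟩ := key a ha
    obtain ⟨D, hD, rfl⟩ := key b hb
    refine ⟨U, D, hup U hU, hdown D hD, rfl, rfl, ?_⟩
    rcases subset_singleton_iff.1 hU with rfl | rfl <;>
    rcases subset_singleton_iff.1 hD with rfl | rfl <;> simp [maxInter]
  | insert x Y hx ih =>
    intro a b ha hb
    rw [card_insert_of_notMem hx] at ha hb ⊢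
    have hpow : 2 ^ (Y.card + 1) = 2 ^ Y.card + 2 ^ Y.card := by rw [pow_succ]; omega
    rcases le_or_gt a (2 ^ Y.card) with h | h
    · obtain ⟨U, D, hU, hD, rfl, hb', hUD⟩ := ih a (b / 2) h (by omega)
      obtain ⟨E, hE, hDE, hcard⟩ : ∃ E, IsDownFam Y E ∧ D ⊆ E ∧ E.card = (b + 1) / 2 := by
        rcases Nat.even_or_odd' b with ⟨c, rfl | rfl⟩
        · exact ⟨D, hD, Subset.rfl, by omega⟩
        · obtain ⟨E, hE, hDE, hcard⟩ := hD.exists_card_succ (by omega)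
          exact ⟨E, hE, hDE, by omega⟩
      have hempty : IsUpFam Y ∅ := ⟨empty_subset _, by simp⟩
      refine ⟨glue x ∅ U, glue x E D, hempty.glue hx hU (empty_subset _), hE.glue hx hD hDE,
        ?_, ?_, ?_⟩
      · rw [card_glue hx hempty.1 hU.1, card_empty, zero_add]
      · rw [card_glue hx hE.1 hD.1]; omega
      · rw [glue_inter_glue hx hempty.1 hU.1 hE.1 hD.1, card_glue hx
          (inter_subset_left.trans hempty.1) (inter_subset_left.trans hU.1),
          maxInter_of_le _ h]
        omega
    · obtain ⟨U, D, hU, hD, hU', hb', hUD⟩ :=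
        ih (a - 2 ^ Y.card) ((b + 1) / 2) (by omega) (by omega)
      obtain ⟨E, hE, hED, hcard⟩ : ∃ E, IsDownFam Y E ∧ E ⊆ D ∧ E.card = b / 2 := by
        rcases Nat.even_or_odd' b with ⟨c, rfl | rfl⟩
        · exact ⟨D, hD, Subset.rfl, by omega⟩
        · obtain ⟨E, hE, hDE, hcard⟩ := hD.exists_card_add_one_eq (by omega)
          exact ⟨E, hE, hDE, by omega⟩
      have hfull : IsUpFam Y Y.powerset := ⟨Subset.rfl, fun S _ T _ hT => mem_powerset.2 hT⟩
      refine ⟨glue x U Y.powerset, glue x D E, hU.glue hx hfull hU.1, hD.glue hx hE hED,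
        ?_, ?_, ?_⟩
      · rw [card_glue hx hU.1 hfull.1, card_powerset]; omega
      · rw [card_glue hx hD.1 hE.1]; omega
      · rw [glue_inter_glue hx hU.1 hfull.1 hD.1 hE.1, card_glue hx
          (inter_subset_left.trans hU.1) (inter_subset_left.trans hfull.1),
          maxInter_of_lt _ h, inter_eq_right.2 hE.1]
        omega

theorem exists_card_add_two_le_of_card_le {X : Finset ℕ} (hX : X.Nonempty)
    {U D : Finset (Finset ℕ)} (hU : IsUpFam X U) (hD : IsDownFam X D) (hUD : 0 < (U ∩ D).card)
    (hcard : U.card ≤ 2 ^ (X.card - 1)) :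
    ∃ V E, IsUpFam X V ∧ IsDownFam X E ∧ V.card + E.card + 2 ≤ U.card + D.card ∧
      (U ∩ D).card ≤ (V ∩ E).card + 1 := by
  obtain ⟨x, hx⟩ := hX
  obtain ⟨Y, hxY, rfl⟩ : ∃ Y, x ∉ Y ∧ X = insert x Y :=
    ⟨X.erase x, notMem_erase _ _, (insert_erase hx).symm⟩
  have hle := card_inter_le_maxInter _ U D hU hD
  have hD2 : D.card ≤ 2 ^ (Y.card + 1) := by
    simpa [card_insert_of_notMem hxY] using card_le_card hD.1
  rw [card_insert_of_notMem hxY] at hle hcard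
  rw [Nat.add_sub_cancel] at hcard
  rw [maxInter_of_le _ hcard] at hle
  have hD0 : 0 < D.card / 2 := by
    rcases Nat.eq_zero_or_pos (D.card / 2) with h | h
    · rw [h, maxInter_zero_right _ _ hcard] at hle; omega
    · exact h
  obtain ⟨V, E, hV, hE, hVcard, hEcard, hVE⟩ :=
    exists_maxInter_le_card_inter Y U.card (D.card / 2 - 1) hcard
      (by rw [pow_succ] at hD2; omega)
  have hempty : IsUpFam Y ∅ := ⟨empty_subset _, by simp⟩
  refine ⟨glue x ∅ V, glue x E E, hempty.glue hxY hV (empty_subset _),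
    hE.glue hxY hE Subset.rfl, ?_, ?_⟩
  · rw [card_glue hxY hempty.1 hV.1, card_glue hxY hE.1 hE.1, card_empty]; omega
  · rw [glue_inter_glue hxY hempty.1 hV.1 hE.1 hE.1, card_glue hxY
      (inter_subset_left.trans hempty.1) (inter_subset_left.trans hV.1)]
    have := maxInter_le_add_sub Y.card U.card (D.card / 2 - 1) (D.card / 2)
    omega

theorem compl_mem_image_compl {X S : Finset ℕ} {U : Finset (Finset ℕ)} (hU : U ⊆ X.powerset)
    (hS : S ⊆ X) : S ∈ U.image (X \ ·) ↔ X \ S ∈ U := by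
  rw [mem_image]
  constructor
  · rintro ⟨T, hT, rfl⟩
    rwa [Finset.sdiff_sdiff_eq_self (subset_of_mem_family hU hT)]
  · exact fun h => ⟨_, h, Finset.sdiff_sdiff_eq_self hS⟩

theorem image_compl_subset (X : Finset ℕ) (U : Finset (Finset ℕ)) :
    U.image (X \ ·) ⊆ X.powerset := by
  intro S hS
  obtain ⟨T, -, rfl⟩ := mem_image.1 hS
  exact mem_powerset.2 sdiff_subset

theorem card_image_compl {X : Finset ℕ} {U : Finset (Finset ℕ)} (hU : U ⊆ X.powerset) :
    (U.image (X \ ·)).card = U.card := by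
  refine card_image_of_injOn fun S hS T hT h => ?_
  rw [← Finset.sdiff_sdiff_eq_self (subset_of_mem_family hU hS),
    ← Finset.sdiff_sdiff_eq_self (subset_of_mem_family hU hT)]
  exact congrArg (X \ ·) h

theorem image_compl_inter {X : Finset ℕ} {U D : Finset (Finset ℕ)} (hU : U ⊆ X.powerset)
    (hD : D ⊆ X.powerset) : (U ∩ D).image (X \ ·) = U.image (X \ ·) ∩ D.image (X \ ·) := by
  ext S
  by_cases hS : S ⊆ X
  · rw [mem_inter, compl_mem_image_compl (inter_subset_left.trans hU) hS,
      compl_mem_image_compl hU hS, compl_mem_image_compl hD hS, mem_inter]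
  · refine iff_of_false (fun h => hS ?_) (fun h => hS ?_)
    · exact subset_of_mem_family (image_compl_subset X _) h
    · exact subset_of_mem_family (image_compl_subset X _) (mem_inter.1 h).1

theorem IsUpFam.image_compl {X : Finset ℕ} {U : Finset (Finset ℕ)} (hU : IsUpFam X U) :
    IsDownFam X (U.image (X \ ·)) := by
  refine ⟨image_compl_subset X U, fun S hS T hTS => ?_⟩
  have hSX := subset_of_mem_family (image_compl_subset X U) hS
  rw [compl_mem_image_compl hU.1 hSX] at hS
  rw [compl_mem_image_compl hU.1 (hTS.trans hSX)]
  exact hU.2 _ hS _ (sdiff_subset_sdiff Subset.rfl hTS) sdiff_subset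

theorem IsDownFam.image_compl {X : Finset ℕ} {D : Finset (Finset ℕ)} (hD : IsDownFam X D) :
    IsUpFam X (D.image (X \ ·)) := by
  refine ⟨image_compl_subset X D, fun S hS T hST hT => ?_⟩
  rw [compl_mem_image_compl hD.1 (hST.trans hT)] at hS
  rw [compl_mem_image_compl hD.1 hT]
  exact hD.2 _ hS _ (sdiff_subset_sdiff Subset.rfl hST)

theorem exists_card_add_two_le {X : Finset ℕ} (hX : X.Nonempty)
    {U D : Finset (Finset ℕ)} (hU : IsUpFam X U) (hD : IsDownFam X D) (hUD : 0 < (U ∩ D).card)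
    (hcard : U.card ≤ 2 ^ (X.card - 1) ∨ D.card ≤ 2 ^ (X.card - 1)) :
    ∃ V E, IsUpFam X V ∧ IsDownFam X E ∧ V.card + E.card + 2 ≤ U.card + D.card ∧
      (U ∩ D).card ≤ (V ∩ E).card + 1 := by
  rcases hcard with h | h
  · exact exists_card_add_two_le_of_card_le hX hU hD hUD h
  · have hinter : (D.image (X \ ·) ∩ U.image (X \ ·)).card = (U ∩ D).card := by
      rw [← image_compl_inter hD.1 hU.1, card_image_compl (inter_subset_left.trans hD.1),
        inter_comm]
    have := exists_card_add_two_le_of_card_le hX hD.image_compl hU.image_compl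
      (by rwa [hinter]) (by rwa [card_image_compl hD.1])
    rwa [hinter, card_image_compl hD.1, card_image_compl hU.1, add_comm D.card] at this

section Closure

variable {X : Finset ℕ} {F G H : Finset (Finset ℕ)}

theorem mem_udClo {S : Finset ℕ} :
    S ∈ udClo X F ↔ S ⊆ X ∧ ∃ A ∈ F, A ⊆ S ∨ S ⊆ A := by
  simp only [udClo, upClo, downClo, mem_union, mem_filter, mem_powerset]
  constructor
  · rintro (⟨h, A, hA, hAS⟩ | ⟨h, A, hA, hAS⟩)
    · exact ⟨h, A, hA, Or.inl hAS⟩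
    · exact ⟨h, A, hA, Or.inr hAS⟩
  · rintro ⟨h, A, hA, hAS | hAS⟩
    · exact Or.inl ⟨h, A, hA, hAS⟩
    · exact Or.inr ⟨h, A, hA, hAS⟩

theorem udClo_subset : udClo X F ⊆ X.powerset := fun _ hS =>
  mem_powerset.2 (mem_udClo.1 hS).1

theorem subset_upClo (hF : F ⊆ X.powerset) : F ⊆ upClo X F := fun S hS =>
  mem_filter.2 ⟨hF hS, S, hS, Subset.rfl⟩

theorem subset_downClo (hF : F ⊆ X.powerset) : F ⊆ downClo X F := fun S hS =>
  mem_filter.2 ⟨hF hS, S, hS, Subset.rfl⟩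

theorem isUpFam_upClo : IsUpFam X (upClo X F) := by
  refine ⟨filter_subset _ _, fun S hS T hST hT => ?_⟩
  obtain ⟨-, A, hA, hAS⟩ := mem_filter.1 hS
  exact mem_filter.2 ⟨mem_powerset.2 hT, A, hA, hAS.trans hST⟩

theorem isDownFam_downClo : IsDownFam X (downClo X F) := by
  refine ⟨filter_subset _ _, fun S hS T hTS => ?_⟩
  obtain ⟨hS, A, hA, hAS⟩ := mem_filter.1 hS
  exact mem_filter.2 ⟨mem_powerset.2 (hTS.trans (mem_powerset.1 hS)), A, hA, hTS.trans hAS⟩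

theorem udClo_subset_union {U D : Finset (Finset ℕ)} (hU : IsUpFam X U) (hD : IsDownFam X D)
    (hF : F ⊆ U ∩ D) : udClo X F ⊆ U ∪ D := fun S hS => by
  obtain ⟨hS, A, hA, hAS | hAS⟩ := mem_udClo.1 hS
  · exact mem_union_left _ (hU.2 _ (mem_inter.1 (hF hA)).1 _ hAS hS)
  · exact mem_union_right _ (hD.2 _ (mem_inter.1 (hF hA)).2 _ hAS)

/-- Being disjoint from the two-sided closure is a symmetric relation between families. -/
theorem subset_sdiff_udClo_comm (hG : G ⊆ X.powerset) (h : H ⊆ X.powerset \ udClo X G) :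
    G ⊆ X.powerset \ udClo X H := fun S hS => by
  refine mem_sdiff.2 ⟨hG hS, fun hS' => ?_⟩
  obtain ⟨-, A, hA, hAS⟩ := mem_udClo.1 hS'
  obtain ⟨hAX, hAG⟩ := mem_sdiff.1 (h hA)
  exact hAG (mem_udClo.2 ⟨mem_powerset.1 hAX, S, hS, hAS.symm⟩)

theorem isConvex_sdiff_udClo : IsConvex X (X.powerset \ udClo X G) := by
  refine Subset.antisymm (fun S hS => ?_)
    (subset_inter (subset_upClo sdiff_subset) (subset_downClo sdiff_subset))
  obtain ⟨hS1, hS2⟩ := mem_inter.1 hS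
  obtain ⟨hSX, A, hA, hAS⟩ := mem_filter.1 hS1
  obtain ⟨-, B, hB, hSB⟩ := mem_filter.1 hS2
  obtain ⟨hAX, hA⟩ := mem_sdiff.1 hA
  obtain ⟨hBX, hB⟩ := mem_sdiff.1 hB
  refine mem_sdiff.2 ⟨hSX, fun hSG => ?_⟩
  obtain ⟨-, C, hC, hCS | hSC⟩ := mem_udClo.1 hSG
  · exact hB (mem_udClo.2 ⟨mem_powerset.1 hBX, C, hC, Or.inl (hCS.trans hSB)⟩)
  · exact hA (mem_udClo.2 ⟨mem_powerset.1 hAX, C, hC, Or.inr (hAS.trans hSC)⟩)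

theorem card_add_card_udClo_le (hG : G ⊆ X.powerset) (h : H ⊆ X.powerset \ udClo X G) :
    G.card + (udClo X H).card ≤ 2 ^ X.card := by
  have h1 := card_le_card (subset_sdiff_udClo_comm hG h)
  rw [card_sdiff_of_subset udClo_subset, card_powerset] at h1
  have h2 := card_le_card (udClo_subset (X := X) (F := H))
  rw [card_powerset] at h2
  omega

end Closure

theorem card_groundSet (n : ℕ) : (groundSet n).card = n := by simp [groundSet]

theorem Phi_le {n : ℕ} {F : Finset (Finset ℕ)} (hF : F ⊆ (groundSet n).powerset) :
    Phi n F.card ≤ (udClo (groundSet n) F).card :=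
  Nat.sInf_le ⟨F, hF, rfl, rfl⟩

theorem exists_card_udClo_eq_Phi {n m : ℕ} (hm : m ≤ 2 ^ n) :
    ∃ F ⊆ (groundSet n).powerset, F.card = m ∧ (udClo (groundSet n) F).card = Phi n m := by
  have hne : {k | ∃ F : Finset (Finset ℕ), F ⊆ (groundSet n).powerset ∧ F.card = m ∧
      (udClo (groundSet n) F).card = k}.Nonempty := by
    obtain ⟨F, hF, hFm⟩ := exists_subset_card_eq (s := (groundSet n).powerset) (n := m)
      (by rwa [card_powerset, card_groundSet])
    exact ⟨_, F, hF, hFm, rfl⟩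
  exact Nat.sInf_mem hne

theorem Phi_le_card_union {n m : ℕ} {U D : Finset (Finset ℕ)} (hU : IsUpFam (groundSet n) U)
    (hD : IsDownFam (groundSet n) D) (hm : m ≤ (U ∩ D).card) : Phi n m ≤ (U ∪ D).card := by
  obtain ⟨F, hF, rfl⟩ := exists_subset_card_eq hm
  exact (Phi_le (hF.trans (inter_subset_left.trans hU.1))).trans
    (card_le_card (udClo_subset_union hU hD hF))

theorem IsUpFam.sdiff {X : Finset ℕ} {U : Finset (Finset ℕ)} (hU : IsUpFam X U) :
    IsDownFam X (X.powerset \ U) := by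
  refine ⟨sdiff_subset, fun S hS T hTS => ?_⟩
  rw [mem_sdiff, mem_powerset] at hS ⊢
  exact ⟨hTS.trans hS.1, fun hT => hS.2 (hU.2 _ hT _ hTS hS.1)⟩

theorem IsDownFam.sdiff {X : Finset ℕ} {D : Finset (Finset ℕ)} (hD : IsDownFam X D) :
    IsUpFam X (X.powerset \ D) := by
  refine ⟨sdiff_subset, fun S hS T hST hT => ?_⟩
  rw [mem_sdiff, mem_powerset] at hS ⊢
  exact ⟨hT, fun hTD => hS.2 (hD.2 _ hTD _ hST)⟩

theorem le_card_union_of_lt_card {X : Finset ℕ} {U D : Finset (Finset ℕ)} {k : ℕ}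
    (hU : IsUpFam X U) (hD : IsDownFam X D) (hX : X.card = k + 2)
    (hUcard : 2 ^ (k + 1) < U.card) (hDcard : 2 ^ (k + 1) < D.card) :
    2 ^ (k + 2) - 2 ^ k ≤ (U ∪ D).card := by
  have hpow : 2 ^ (k + 1) = 2 ^ k + 2 ^ k := by rw [pow_succ]; omega
  have hpow' : 2 ^ (k + 2) = 2 ^ (k + 1) + 2 ^ (k + 1) := by rw [pow_succ]; omega
  have hpos : 0 < 2 ^ k := by positivity
  have h := card_inter_le_maxInter X _ _ hD.sdiff hU.sdiff
  have hD' : (X.powerset \ D).card ≤ 2 ^ (k + 1) := by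
    rw [card_sdiff_of_subset hD.1, card_powerset, hX]; omega
  have hU' : (X.powerset \ U).card ≤ 2 ^ (k + 1) := by
    rw [card_sdiff_of_subset hU.1, card_powerset, hX]; omega
  have hlip := maxInter_le_add_sub (k + 1) (X.powerset \ D).card 0
    ((X.powerset \ U).card / 2)
  rw [maxInter_zero_right _ _ hD'] at hlip
  rw [hX, maxInter_of_le _ hD', ← sdiff_union_distrib,
    card_sdiff_of_subset (union_subset hD.1 hU.1), card_powerset, hX, union_comm] at h
  omega

/-- `Φ(n,·)` is strictly increasing up to `2 ^ (n - 2)`. -/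
theorem Phi_lt_Phi_succ {n ℓ : ℕ} (hn : 2 ≤ n) (hℓ : ℓ < 2 ^ (n - 2)) :
    Phi n ℓ < Phi n (ℓ + 1) := by
  obtain ⟨k, rfl⟩ := Nat.exists_eq_add_of_le' hn
  rw [Nat.add_sub_cancel] at hℓ
  have hpow : 2 ^ (k + 1) = 2 ^ k + 2 ^ k := by rw [pow_succ]; omega
  have hpow' : 2 ^ (k + 2) = 2 ^ (k + 1) + 2 ^ (k + 1) := by rw [pow_succ]; omega
  have hne : (groundSet (k + 2)).Nonempty := by rw [← card_pos, card_groundSet]; omega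
  obtain ⟨U, D, hU, hD, hUD, hcard, hunion⟩ : ∃ U D, IsUpFam (groundSet (k + 2)) U ∧
      IsDownFam (groundSet (k + 2)) D ∧ ℓ + 1 ≤ (U ∩ D).card ∧
      (U.card ≤ 2 ^ (k + 1) ∨ D.card ≤ 2 ^ (k + 1)) ∧
      (U ∪ D).card ≤ Phi (k + 2) (ℓ + 1) := by
    obtain ⟨F, hF, hFcard, hFPhi⟩ :=
      exists_card_udClo_eq_Phi (n := k + 2) (m := ℓ + 1) (by omega)
    by_cases hsmall : (upClo (groundSet (k + 2)) F).card ≤ 2 ^ (k + 1) ∨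
        (downClo (groundSet (k + 2)) F).card ≤ 2 ^ (k + 1)
    · refine ⟨_, _, isUpFam_upClo, isDownFam_downClo, ?_, hsmall, hFPhi.le⟩
      rw [← hFcard]
      exact card_le_card (subset_inter (subset_upClo hF) (subset_downClo hF))
    · obtain ⟨U, D, hU, hD, hUcard, hDcard, hUD⟩ :=
        exists_maxInter_le_card_inter (groundSet (k + 2)) (2 ^ (k + 1)) (2 ^ (k + 1))
          (by rw [card_groundSet]; omega) (by rw [card_groundSet]; omega)
      rw [card_groundSet, maxInter_of_le _ le_rfl,
        show 2 ^ (k + 1) / 2 = 2 ^ k by omega, maxInter_two_pow_left _ _ (by omega)] at hUD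
      have h1 := card_union_add_card_inter U D
      have h2 := le_card_union_of_lt_card (k := k) (isUpFam_upClo (F := F))
        (isDownFam_downClo (F := F))
        (card_groundSet _) (by omega) (by omega)
      exact ⟨U, D, hU, hD, by omega, Or.inl hUcard.le, by rw [← hFPhi, udClo]; omega⟩
  obtain ⟨V, E, hV, hE, hVE, hinter⟩ := exists_card_add_two_le hne hU hD (by omega)
    (by rwa [card_groundSet])
  have h1 := card_union_add_card_inter U D
  have h2 := card_union_add_card_inter V E
  have h3 := Phi_le_card_union hV hE (m := ℓ) (by omega)
  omega

theorem rev_subset {n : ℕ} {A : Finset ℕ} (hA : A ⊆ groundSet n) :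
    rev n A ⊆ groundSet n := by
  intro y hy
  obtain ⟨x, hx, rfl⟩ := mem_image.1 hy
  have := mem_Icc.1 (hA hx)
  exact mem_Icc.2 (by omega)

theorem rev_rev {n : ℕ} {A : Finset ℕ} (hA : A ⊆ groundSet n) : rev n (rev n A) = A := by
  have : ∀ x ∈ A, n + 1 - (n + 1 - x) = x := fun x hx => by
    have := mem_Icc.1 (hA hx); omega
  rw [rev, rev, image_image]
  exact (image_congr this).trans image_id'

theorem card_revFam {n : ℕ} {F : Finset (Finset ℕ)} (hF : F ⊆ (groundSet n).powerset) :
    (revFam n F).card = F.card := by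
  refine card_image_of_injOn fun S hS T hT h => ?_
  rw [← rev_rev (subset_of_mem_family hF hS), ← rev_rev (subset_of_mem_family hF hT)]
  exact congrArg (rev n) h

theorem revFam_subset {n : ℕ} {F : Finset (Finset ℕ)} (hF : F ⊆ (groundSet n).powerset) :
    revFam n F ⊆ (groundSet n).powerset := by
  intro S hS
  obtain ⟨T, hT, rfl⟩ := mem_image.1 hS
  exact mem_powerset.2 (rev_subset (subset_of_mem_family hF hT))

theorem udClo_revFam {n : ℕ} {F : Finset (Finset ℕ)} (hF : F ⊆ (groundSet n).powerset) :
    udClo (groundSet n) (revFam n F) = revFam n (udClo (groundSet n) F) := by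
  ext S
  rw [mem_udClo, revFam, revFam, mem_image]
  constructor
  · rintro ⟨hS, _, hA, h⟩
    obtain ⟨A, hAF, rfl⟩ := mem_image.1 hA
    refine ⟨rev n S, mem_udClo.2 ⟨rev_subset hS, A, hAF, ?_⟩, rev_rev hS⟩
    rw [← rev_rev (subset_of_mem_family hF hAF)]
    exact h.imp (image_subset_image ·) (image_subset_image ·)
  · rintro ⟨T, hT, rfl⟩
    obtain ⟨hT, A, hA, h⟩ := mem_udClo.1 hT
    exact ⟨rev_subset hT, rev n A, mem_image_of_mem _ hA,
      h.imp (image_subset_image ·) (image_subset_image ·)⟩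

/-- Lemma 18: if `𝓕_ℓ` is an `(n,ℓ)`-witness family with `ℓ < 2^(n-2)`, then `𝓕*_ℓ` is a
convex `(n,ℓ*)`-witness family (where `ℓ* = 2^n - Φ(n,ℓ)`), and `Φ(n,m) = 2^n - ℓ` for
each `m ∈ {(ℓ+1)* + 1, …, ℓ*}`. -/
theorem stmt17 (n ℓ : ℕ) (hn : 2 ≤ n) (hℓ : ℓ < 2 ^ (n - 2))
    (F : Finset (Finset ℕ)) (hF : F ⊆ (groundSet n).powerset)
    (hcard : F.card = ℓ) (hwit : (udClo (groundSet n) F).card = Phi n ℓ) :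
    IsConvex (groundSet n) (conjFam n F) ∧
    (conjFam n F).card = 2 ^ n - Phi n ℓ ∧
    (udClo (groundSet n) (conjFam n F)).card = Phi n (2 ^ n - Phi n ℓ) ∧
    ∀ m, 2 ^ n - Phi n (ℓ + 1) + 1 ≤ m → m ≤ 2 ^ n - Phi n ℓ →
      Phi n m = 2 ^ n - ℓ := by
  have hF' := revFam_subset hF
  have hcard' : (revFam n F).card = ℓ := by rw [card_revFam hF, hcard]
  have hwit' : (udClo (groundSet n) (revFam n F)).card = Phi n ℓ := by
    rw [udClo_revFam hF, card_revFam udClo_subset, hwit]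
  have hconj : (conjFam n F).card = 2 ^ n - Phi n ℓ := by
    rw [conjFam, card_sdiff_of_subset udClo_subset, card_powerset, card_groundSet, hwit']
  have upper : ∀ H ⊆ conjFam n F, ℓ + (udClo (groundSet n) H).card ≤ 2 ^ n := fun H hH => by
    have := card_add_card_udClo_le hF' hH
    rwa [hcard', card_groundSet] at this
  have lower : ∀ m, 2 ^ n - Phi n (ℓ + 1) + 1 ≤ m → m ≤ 2 ^ n → 2 ^ n - ℓ ≤ Phi n m := by
    intro m hm hm'
    obtain ⟨G, hG, rfl, hGPhi⟩ := exists_card_udClo_eq_Phi hm'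
    by_contra! hlt
    obtain ⟨H, hH, hHcard⟩ :=
      exists_subset_card_eq (s := (groundSet n).powerset \ udClo (groundSet n) G) (n := ℓ + 1)
        (by
          rw [card_sdiff_of_subset udClo_subset, card_powerset, card_groundSet, hGPhi]
          omega)
    have h1 := card_add_card_udClo_le hG hH
    have h2 := Phi_le (hH.trans sdiff_subset)
    rw [card_groundSet] at h1
    rw [hHcard] at h2
    omega
  have hPhi : ∀ m, 2 ^ n - Phi n (ℓ + 1) + 1 ≤ m → m ≤ 2 ^ n - Phi n ℓ →
      Phi n m = 2 ^ n - ℓ := by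
    intro m hm hm'
    refine le_antisymm ?_ (lower m hm (hm'.trans (Nat.sub_le _ _)))
    obtain ⟨H, hH, rfl⟩ := exists_subset_card_eq (hm'.trans hconj.ge)
    have h1 := upper H hH
    have h2 := Phi_le (hH.trans sdiff_subset)
    omega
  refine ⟨isConvex_sdiff_udClo, hconj, le_antisymm ?_ ?_, hPhi⟩
  · have hle : Phi n ℓ ≤ 2 ^ n := by
      rw [← hwit', ← card_groundSet n, ← card_powerset, card_groundSet]
      exact card_le_card udClo_subset
    have hsucc : Phi n (ℓ + 1) ≤ 2 ^ n := by
      have hpow : 2 ^ (n - 2) ≤ 2 ^ n := Nat.pow_le_pow_right (by omega) (by omega)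
      obtain ⟨G, -, -, hG⟩ := exists_card_udClo_eq_Phi (n := n) (m := ℓ + 1) (by omega)
      rw [← hG]
      simpa [card_groundSet] using card_le_card (udClo_subset (X := groundSet n) (F := G))
    have hlt := Phi_lt_Phi_succ hn hℓ
    rw [hPhi _ (by omega) le_rfl]
    have := upper _ Subset.rfl
    omega
  · rw [← hconj]
    exact Phi_le sdiff_subset
end

section
/- Let n be a nonnegative integer and let 0 ≤ i < j ≤ 2^n. Let 𝓕_i be a convex family of subsets of [n] with |𝓕_i| = i and 𝓕_j a convex family of subsets of [n] with |𝓕_j| = j, such that 𝓕_i ⊊ 𝓕_j. Then there exist convex families 𝓕_{i+1},…,𝓕_{j−1} of subsets of [n] such that |𝓕_m| = m for each m ∈ {i+1,…,j−1} and 𝓕_i ⊊ 𝓕_{i+1} ⊊ ⋯ ⊊ 𝓕_{j−1} ⊊ 𝓕_j. -/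
open Finset

/-- Between two order-connected finite sets there is always a one-point order-connected extension
of the smaller one. -/
theorem exists_insert_ordConnected {α : Type*} [PartialOrder α] [DecidableEq α] {F G : Finset α}
    (hF : (F : Set α).OrdConnected) (hG : (G : Set α).OrdConnected) (h : F ⊂ G) :
    ∃ x ∈ G, x ∉ F ∧ ((insert x F : Finset α) : Set α).OrdConnected := by
  by_cases hup : ∃ x ∈ G \ F, ∃ a ∈ F, a ≤ x
  · have hne : ({x ∈ (G \ F : Finset α) | ∃ a ∈ F, a ≤ x} : Set α).Nonempty := by
      obtain ⟨x, hx, ha⟩ := hup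
      exact ⟨x, hx, ha⟩
    obtain ⟨x, hx⟩ := ((G \ F).finite_toSet.subset fun _ hy => hy.1).exists_minimal hne
    obtain ⟨⟨hxGF, c, hc, hcx⟩, hmin⟩ := hx
    obtain ⟨hxG, hxF⟩ := Finset.mem_sdiff.1 hxGF
    refine ⟨x, hxG, hxF, ⟨fun a ha b hb s hs => ?_⟩⟩
    rw [Finset.mem_coe, Finset.mem_insert] at ha hb ⊢
    rcases ha with rfl | ha <;> rcases hb with rfl | hb
    · exact Or.inl (le_antisymm hs.2 hs.1)
    · exact absurd (hF.out hc hb ⟨hcx, hs.1.trans hs.2⟩) hxF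
    · by_cases hsF : s ∈ F
      · exact Or.inr hsF
      · have hsG : s ∈ G := hG.out (h.1 ha) hxG hs
        exact Or.inl (le_antisymm hs.2
          (hmin ⟨Finset.mem_sdiff.2 ⟨hsG, hsF⟩, a, ha, hs.1⟩ hs.2))
    · exact Or.inr (hF.out ha hb hs)
  · obtain ⟨x, hxGF, hmax⟩ := (G \ F).exists_maximal (Finset.sdiff_nonempty.2 h.2)
    obtain ⟨hxG, hxF⟩ := Finset.mem_sdiff.1 hxGF
    refine ⟨x, hxG, hxF, ⟨fun a ha b hb s hs => ?_⟩⟩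
    rw [Finset.mem_coe, Finset.mem_insert] at ha hb ⊢
    rcases ha with rfl | ha <;> rcases hb with rfl | hb
    · exact Or.inl (le_antisymm hs.2 hs.1)
    · by_cases hsF : s ∈ F
      · exact Or.inr hsF
      · have hsG : s ∈ G := hG.out hxG (h.1 hb) hs
        exact Or.inl (le_antisymm (hmax (Finset.mem_sdiff.2 ⟨hsG, hsF⟩) hs.1) hs.1)
    · exact absurd ⟨b, hxGF, a, ha, hs.1.trans hs.2⟩ hup
    · exact Or.inr (hF.out ha hb hs)

/-- Nested order-connected finite sets are joined by a chain of order-connected sets that grows by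
one element at a time. -/
theorem exists_ordConnected_chain {α : Type*} [PartialOrder α] {G : Finset α}
    (hG : (G : Set α).OrdConnected) (k : ℕ) {i : ℕ} {F : Finset α}
    (hF : (F : Set α).OrdConnected) (hFG : F ⊆ G) (hi : F.card = i) (hk : G.card = i + k) :
    ∃ C : ℕ → Finset α, C i = F ∧ C (i + k) = G ∧
      (∀ m, i ≤ m → m ≤ i + k → (C m).card = m ∧ C m ⊆ G ∧ (C m : Set α).OrdConnected) ∧
      (∀ m, i ≤ m → m < i + k → C m ⊂ C (m + 1)) := by
  classical
  induction k generalizing i F with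
  | zero =>
    obtain rfl := Finset.eq_of_subset_of_card_le hFG (by omega)
    refine ⟨fun _ => F, rfl, rfl, fun m h₁ h₂ => ⟨hi.trans (by omega), hFG, hF⟩, fun m h₁ h₂ => by omega⟩
  | succ k ih =>
    have hss : F ⊂ G := hFG.ssubset_of_ne (by rintro rfl; omega)
    obtain ⟨x, hxG, hxF, hx⟩ := exists_insert_ordConnected hF hG hss
    obtain ⟨C, hCi, hCG, hC, hlt⟩ := ih (i := i + 1) hx
      (Finset.insert_subset hxG hFG) (by rw [Finset.card_insert_of_notMem hxF, hi]) (by omega)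
    have heq : i + 1 + k = i + (k + 1) := by omega
    rw [heq] at hCG hC hlt
    have hne {m : ℕ} (hm : i < m) : Function.update C i F m = C m :=
      Function.update_of_ne hm.ne' _ _
    refine ⟨Function.update C i F, Function.update_self .., by rw [hne (by omega), hCG],
      fun m h₁ h₂ => ?_, fun m h₁ h₂ => ?_⟩
    · rcases h₁.eq_or_lt with rfl | h₁
      · rw [Function.update_self]
        exact ⟨hi, hFG, hF⟩
      · rw [hne h₁]
        exact hC m h₁ h₂
    · rw [hne (Nat.lt_succ_of_le h₁)]
      rcases h₁.eq_or_lt with rfl | h₁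
      · rw [Function.update_self, hCi]
        exact Finset.ssubset_insert hxF
      · rw [hne h₁]
        exact hlt m h₁ h₂

theorem isConvex_iff_ordConnected {X : Finset ℕ} {F : Finset (Finset ℕ)} (hF : F ⊆ X.powerset) :
    IsConvex X F ↔ (F : Set (Finset ℕ)).OrdConnected := by
  have hmem (S : Finset ℕ) : S ∈ upClo X F ∩ downClo X F ↔
      S ⊆ X ∧ (∃ A ∈ F, A ⊆ S) ∧ ∃ B ∈ F, S ⊆ B := by
    simp only [upClo, downClo, Finset.mem_inter, Finset.mem_filter, Finset.mem_powerset]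
    tauto
  constructor
  · refine fun h => ⟨fun A hA B hB S hS => ?_⟩
    rw [Finset.mem_coe, ← h, hmem]
    exact ⟨hS.2.trans (Finset.mem_powerset.1 (hF hB)), ⟨A, hA, hS.1⟩, B, hB, hS.2⟩
  · refine fun h => Finset.ext fun S => ?_
    rw [hmem]
    constructor
    · rintro ⟨-, ⟨A, hA, hAS⟩, B, hB, hSB⟩
      exact h.out hA hB ⟨hAS, hSB⟩
    · exact fun hS => ⟨Finset.mem_powerset.1 (hF hS), ⟨S, hS, subset_rfl⟩, S, hS, subset_rfl⟩

/-- Lemma 19 (interpolation): given convex families `𝓕ᵢ ⊊ 𝓕ⱼ` of subsets of `[n]` with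
`|𝓕ᵢ| = i` and `|𝓕ⱼ| = j`, there are convex families `𝓕_{i+1}, …, 𝓕_{j-1}` with
`|𝓕ₘ| = m` for `i < m < j` and `𝓕ᵢ ⊊ 𝓕_{i+1} ⊊ ⋯ ⊊ 𝓕_{j-1} ⊊ 𝓕ⱼ`. -/
theorem stmt18 (n i j : ℕ) (hij : i < j)
    (Fi Fj : Finset (Finset ℕ))
    (hFi : Fi ⊆ (groundSet n).powerset) (hFj : Fj ⊆ (groundSet n).powerset)
    (hFicard : Fi.card = i) (hFjcard : Fj.card = j)
    (hFiconv : IsConvex (groundSet n) Fi) (hFjconv : IsConvex (groundSet n) Fj)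
    (hsub : Fi ⊂ Fj) :
    ∃ G : ℕ → Finset (Finset ℕ), G i = Fi ∧ G j = Fj ∧
      (∀ m, i ≤ m → m ≤ j → (G m).card = m ∧ IsConvex (groundSet n) (G m)) ∧
      (∀ m, i ≤ m → m < j → G m ⊂ G (m + 1)) := by
  obtain ⟨k, rfl⟩ := Nat.exists_eq_add_of_le hij.le
  obtain ⟨C, hCi, hCj, hC, hlt⟩ := exists_ordConnected_chain
    ((isConvex_iff_ordConnected hFj).1 hFjconv) k
    ((isConvex_iff_ordConnected hFi).1 hFiconv) hsub.1 hFicard hFjcard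
  refine ⟨C, hCi, hCj, fun m h₁ h₂ => ?_, hlt⟩
  obtain ⟨hcard, hCG, hconn⟩ := hC m h₁ h₂
  exact ⟨hcard, (isConvex_iff_ordConnected (hCG.trans hFj)).2 hconn⟩
end

section
/- Let (𝓕,𝓖) be a cross-Sperner pair of families of subsets of [n] such that neither 𝓕 nor 𝓖 is empty. Then n ≥ 2 and |𝓕| + |𝓖| ≤ 2^n − 2^{⌈n/2⌉} − 2^{⌊n/2⌋} + 2. Furthermore, for n ≠ 3, equality holds if and only if one of 𝓕 or 𝓖 consists of exactly one set A of size ⌈n/2⌉ or ⌊n/2⌋ and the other family consists of all subsets of [n] that are neither supersets nor subsets of A. -/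
open Finset

/-- A pair `(𝓕, 𝒢)` of families is cross-Sperner if `F ⊈ G` and `G ⊈ F` for all
`F ∈ 𝓕` and `G ∈ 𝒢`. -/
def CrossSperner (F G : Finset (Finset ℕ)) : Prop :=
  ∀ A ∈ F, ∀ B ∈ G, ¬ A ⊆ B ∧ ¬ B ⊆ A

open scoped FinsetFamily in
/-- Harris–Kleitman: the density of a family in the cube is at most the product of the densities of
its down-closure and its up-closure. -/
theorem card_mul_two_pow_le (X : Finset ℕ) (F : Finset (Finset ℕ)) :
    F.card * 2 ^ X.card ≤ (F ⊼ X.powerset).card * (F ⊻ X.powerset).card := by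
  simpa using Finset.le_card_infs_mul_card_sups F X.powerset

open scoped FinsetFamily in
theorem card_sups_add_card_infs_le {X : Finset ℕ} {F G : Finset (Finset ℕ)}
    (hF : F ⊆ X.powerset) (hG : G ⊆ X.powerset) (h : ∀ A ∈ F, ∀ B ∈ G, ¬ A ⊆ B) :
    (F ⊻ X.powerset).card + (G ⊼ X.powerset).card ≤ 2 ^ X.card := by
  have hdisj : Disjoint (F ⊻ X.powerset) (G ⊼ X.powerset) := by
    rw [Finset.disjoint_left]
    intro S hS hS'
    obtain ⟨A, hA, U, -, rfl⟩ := Finset.mem_sups.1 hS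
    obtain ⟨B, hB, V, -, hBV⟩ := Finset.mem_infs.1 hS'
    exact h A hA B hB ((le_sup_left.trans hBV.ge).trans inf_le_left)
  rw [← Finset.card_union_of_disjoint hdisj, ← Finset.card_powerset]
  refine Finset.card_le_card (Finset.union_subset ?_ ?_)
  · intro S hS
    obtain ⟨A, hA, U, hU, rfl⟩ := Finset.mem_sups.1 hS
    exact Finset.mem_powerset.2
      (Finset.union_subset (Finset.mem_powerset.1 (hF hA)) (Finset.mem_powerset.1 hU))
  · intro S hS
    obtain ⟨B, hB, V, -, rfl⟩ := Finset.mem_infs.1 hS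
    exact Finset.mem_powerset.2
      (Finset.inter_subset_left.trans (Finset.mem_powerset.1 (hG hB)))

/-- Seymour's inequality for cross-Sperner pairs. -/
theorem CrossSperner.sqrt_card_add_sqrt_card_le {X : Finset ℕ} {F G : Finset (Finset ℕ)}
    (hF : F ⊆ X.powerset) (hG : G ⊆ X.powerset) (h : CrossSperner F G) :
    √(F.card : ℝ) + √(G.card : ℝ) ≤ √(2 ^ X.card : ℝ) := by
  have h₁ := card_sups_add_card_infs_le hF hG fun A hA B hB => (h A hA B hB).1
  have h₂ := card_sups_add_card_infs_le hG hF fun B hB A hA => (h A hA B hB).2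
  have h₃ := card_mul_two_pow_le X F
  have h₄ := card_mul_two_pow_le X G
  rify at h₁ h₂ h₃ h₄
  have amgm : ∀ {z p q r : ℝ}, 0 ≤ p → 0 ≤ q → 0 ≤ r → z * r ^ 2 ≤ p * q →
      √z * r ≤ (p + q) / 2 := by
    intro z p q r hp hq hr hz
    rw [← Real.sqrt_sq hr, ← Real.sqrt_mul' _ (sq_nonneg r)]
    exact Real.sqrt_le_iff.2 ⟨by positivity, by nlinarith [sq_nonneg (p - q)]⟩
  have hr : 0 < √(2 ^ X.card : ℝ) := by positivity
  have hr2 : √(2 ^ X.card : ℝ) ^ 2 = 2 ^ X.card := Real.sq_sqrt (by positivity)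
  rw [← hr2] at h₁ h₂ h₃ h₄
  have h₅ := amgm (by positivity) (by positivity) hr.le h₃
  have h₆ := amgm (by positivity) (by positivity) hr.le h₄
  refine le_of_mul_le_mul_right ?_ hr
  nlinarith

theorem CrossSperner.symm {F G : Finset (Finset ℕ)} (h : CrossSperner F G) :
    CrossSperner G F :=
  fun B hB A hA => (h A hA B hB).symm

/-- If both families have at least two members, the bound holds, strictly unless `X` has three
elements. -/
theorem CrossSperner.card_add_card_le_of_two_le {X : Finset ℕ} {F G : Finset (Finset ℕ)}
    (hF : F ⊆ X.powerset) (hG : G ⊆ X.powerset) (h : CrossSperner F G)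
    (hF2 : 2 ≤ F.card) (hG2 : 2 ≤ G.card) :
    (F.card + G.card : ℤ) ≤ 2 ^ X.card - 2 ^ ((X.card + 1) / 2) - 2 ^ (X.card / 2) + 2 ∧
    (X.card ≠ 3 →
      (F.card + G.card : ℤ) <
        2 ^ X.card - 2 ^ ((X.card + 1) / 2) - 2 ^ (X.card / 2) + 2) := by
  have key := h.sqrt_card_add_sqrt_card_le hF hG
  generalize F.card = x at *
  generalize G.card = y at *
  generalize X.card = n at *
  have hs : √2 ≤ √(x : ℝ) := Real.sqrt_le_sqrt (by exact_mod_cast hF2)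
  have ht : √2 ≤ √(y : ℝ) := Real.sqrt_le_sqrt (by exact_mod_cast hG2)
  have hs2 : √(x : ℝ) ^ 2 = x := Real.sq_sqrt (by positivity)
  have ht2 : √(y : ℝ) ^ 2 = y := Real.sq_sqrt (by positivity)
  have h22 : √(2 : ℝ) ^ 2 = 2 := Real.sq_sqrt (by positivity)
  have h2 : (1.4 : ℝ) < √2 := Real.lt_sqrt_of_sq_lt (by norm_num)
  have hbound : (x + y : ℝ) ≤ √(2 ^ n : ℝ) ^ 2 - 2 * √2 * √(2 ^ n : ℝ) + 4 := by
    nlinarith [mul_nonneg (sub_nonneg.2 hs) (sub_nonneg.2 ht)]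
  have hr : 2 * √2 ≤ √(2 ^ n : ℝ) := by linarith
  obtain ⟨m, rfl | rfl⟩ := Nat.even_or_odd' n
  · have hk : √(2 ^ (2 * m) : ℝ) = 2 ^ m := by
      rw [mul_comm, pow_mul, Real.sqrt_sq (by positivity)]
    have e₁ : (2 * m + 1) / 2 = m := by omega
    have e₂ : 2 * m / 2 = m := by omega
    have e₃ : (2 : ℤ) ^ (2 * m) = (2 ^ m) ^ 2 := by rw [mul_comm, pow_mul]
    rw [hk] at hbound hr
    rw [e₁, e₂, e₃]
    have hlt : (x + y : ℤ) < (2 ^ m) ^ 2 - 2 ^ m - 2 ^ m + 2 := by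
      rify
      nlinarith
    exact ⟨hlt.le, fun _ => hlt⟩
  · have hk : √(2 ^ (2 * m + 1) : ℝ) = 2 ^ m * √2 := by
      rw [pow_succ, mul_comm 2 m, pow_mul, Real.sqrt_mul (by positivity),
        Real.sqrt_sq (by positivity)]
    have e₁ : (2 * m + 1 + 1) / 2 = m + 1 := by omega
    have e₂ : (2 * m + 1) / 2 = m := by omega
    have e₃ : (2 : ℤ) ^ (2 * m + 1) = 2 * (2 ^ m) ^ 2 := by
      rw [pow_succ, mul_comm 2 m, pow_mul]
      ring
    rw [hk] at hbound hr
    rw [e₁, e₂, e₃, pow_succ _ m]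
    have hb : (x + y : ℤ) ≤ 2 * (2 ^ m) ^ 2 - 4 * 2 ^ m + 4 := by
      rify
      nlinarith
    have hm : 1 ≤ m := by
      by_contra hm
      obtain rfl : m = 0 := by omega
      norm_num at hr
    constructor
    · have : (2 : ℤ) ^ 1 ≤ 2 ^ m := pow_le_pow_right₀ (by norm_num) hm
      linarith
    · intro hm3
      have : (2 : ℤ) ^ 2 ≤ 2 ^ m := pow_le_pow_right₀ (by norm_num) (by omega)
      linarith

theorem two_pow_half_add_lt {a b : ℕ} (h : a + 2 ≤ b) :
    2 ^ ((a + b + 1) / 2) + 2 ^ ((a + b) / 2) < 2 ^ a + 2 ^ b := by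
  obtain ⟨u, hu⟩ : ∃ u, (a + b) / 2 = a + (u + 1) := ⟨(a + b) / 2 - a - 1, by omega⟩
  obtain ⟨v, hv⟩ : ∃ v, (a + b + 1) / 2 = a + (v + 1) := ⟨(a + b + 1) / 2 - a - 1, by omega⟩
  obtain rfl : b = a + (u + 1) + (v + 1) := by omega
  rw [hu, hv]
  simp only [pow_add, pow_one]
  have ha : 0 < 2 ^ a := by positivity
  have h₁ : 1 ≤ 2 ^ u := Nat.one_le_two_pow
  have h₂ : 1 ≤ 2 ^ v := Nat.one_le_two_pow
  generalize 2 ^ a = p at *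
  generalize 2 ^ u = q at *
  generalize 2 ^ v = r at *
  zify at *
  have h₃ : 0 < (2 * q - 1 : ℤ) * (2 * r - 1) := mul_pos (by linarith) (by linarith)
  nlinarith [mul_pos ha h₃]

theorem two_pow_half_add_le_and_eq_iff {n a : ℕ} (ha : a ≤ n) :
    2 ^ ((n + 1) / 2) + 2 ^ (n / 2) ≤ 2 ^ a + 2 ^ (n - a) ∧
    (2 ^ ((n + 1) / 2) + 2 ^ (n / 2) = 2 ^ a + 2 ^ (n - a) ↔
      a = (n + 1) / 2 ∨ a = n / 2) := by
  obtain ⟨b, rfl⟩ := Nat.exists_eq_add_of_le ha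
  rw [Nat.add_sub_cancel_left]
  by_cases h₁ : a + 2 ≤ b
  · have := two_pow_half_add_lt h₁
    exact ⟨this.le, by constructor <;> intro <;> omega⟩
  by_cases h₂ : b + 2 ≤ a
  · have := two_pow_half_add_lt h₂
    rw [add_comm b a, add_comm (2 ^ b)] at this
    exact ⟨this.le, by constructor <;> intro <;> omega⟩
  have heq : 2 ^ ((a + b + 1) / 2) + 2 ^ ((a + b) / 2) = 2 ^ a + 2 ^ b := by
    obtain h | h | h : a = b ∨ b = a + 1 ∨ a = b + 1 := by omega
    · congr <;> omega
    · rw [add_comm]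
      congr <;> omega
    · congr <;> omega
  exact ⟨heq.le, by simp only [heq, true_iff]; omega⟩

theorem card_filter_incomparable {X A : Finset ℕ} (hA : A ⊆ X) :
    (X.powerset.filter (fun B => ¬ A ⊆ B ∧ ¬ B ⊆ A)).card + 2 ^ A.card +
      2 ^ (X.card - A.card) = 2 ^ X.card + 1 := by
  have hcompl : X.powerset.filter (fun B => ¬ (¬ A ⊆ B ∧ ¬ B ⊆ A)) =
      A.powerset ∪ Finset.Icc A X := by
    ext B
    simp only [mem_filter, mem_powerset, mem_union, mem_Icc]
    have : B ⊆ A → B ⊆ X := fun h => h.trans hA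
    tauto
  have hinter : A.powerset ∩ Finset.Icc A X = {A} := by
    ext B
    simp only [mem_powerset, mem_inter, mem_Icc, mem_singleton]
    exact ⟨fun h => h.1.antisymm h.2.1, by rintro rfl; exact ⟨subset_rfl, subset_rfl, hA⟩⟩
  have h₁ := Finset.card_filter_add_card_filter_not
    (s := X.powerset) (fun B => ¬ A ⊆ B ∧ ¬ B ⊆ A)
  have h₂ := Finset.card_union_add_card_inter A.powerset (Finset.Icc A X)
  rw [hinter, Finset.card_Icc_finset hA, card_powerset, card_singleton] at h₂
  rw [hcompl, card_powerset] at h₁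
  omega

/-- The bound and its equality case when one of the families is a singleton. -/
theorem CrossSperner.card_singleton_add_card_le {X A : Finset ℕ} {G : Finset (Finset ℕ)}
    (hA : A ⊆ X) (hG : G ⊆ X.powerset) (h : CrossSperner {A} G) :
    (1 + G.card : ℤ) ≤ 2 ^ X.card - 2 ^ ((X.card + 1) / 2) - 2 ^ (X.card / 2) + 2 ∧
    ((1 + G.card : ℤ) = 2 ^ X.card - 2 ^ ((X.card + 1) / 2) - 2 ^ (X.card / 2) + 2 ↔
      (A.card = (X.card + 1) / 2 ∨ A.card = X.card / 2) ∧
        G = X.powerset.filter (fun B => ¬ A ⊆ B ∧ ¬ B ⊆ A)) := by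
  have hsub : G ⊆ X.powerset.filter (fun B => ¬ A ⊆ B ∧ ¬ B ⊆ A) := fun B hB =>
    mem_filter.2 ⟨hG hB, h A (mem_singleton_self A) B hB⟩
  have hle := card_le_card hsub
  have hcard := card_filter_incomparable hA
  obtain ⟨hpow, hpow_eq⟩ := two_pow_half_add_le_and_eq_iff (card_le_card hA)
  rw [← hpow_eq]
  zify at hle hcard hpow hpow_eq ⊢
  refine ⟨by linarith, fun heq => ⟨by linarith, eq_of_subset_of_card_le hsub ?_⟩, ?_⟩
  · zify
    linarith
  · rintro ⟨heq, hGeq⟩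
    rw [← hGeq] at hcard
    linarith

theorem CrossSperner.two_le_card {X : Finset ℕ} {F G : Finset (Finset ℕ)}
    (hF : F ⊆ X.powerset) (hG : G ⊆ X.powerset) (hFne : F.Nonempty) (hGne : G.Nonempty)
    (h : CrossSperner F G) : 2 ≤ X.card := by
  obtain ⟨A, hA⟩ := hFne
  obtain ⟨B, hB⟩ := hGne
  obtain ⟨a, haA, haB⟩ := not_subset.1 (h A hA B hB).1
  obtain ⟨b, hbB, hbA⟩ := not_subset.1 (h A hA B hB).2
  exact one_lt_card.2 ⟨a, mem_powerset.1 (hF hA) haA, b, mem_powerset.1 (hG hB) hbB,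
    fun hab => haB (hab ▸ hbB)⟩

/-- Theorem 20: if `(𝓕, 𝒢)` is a cross-Sperner pair of nonempty families of subsets of
`[n]`, then `n ≥ 2` and `|𝓕| + |𝒢| ≤ 2^n - 2^⌈n/2⌉ - 2^⌊n/2⌋ + 2`; moreover for `n ≠ 3`
equality holds iff one of the two families consists of a single set `A` of size `⌈n/2⌉` or
`⌊n/2⌋` and the other consists of all subsets of `[n]` neither containing nor contained
in `A`. -/
theorem stmt19 (n : ℕ) (F G : Finset (Finset ℕ))
    (hF : F ⊆ (groundSet n).powerset) (hG : G ⊆ (groundSet n).powerset)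
    (hFne : F.Nonempty) (hGne : G.Nonempty) (hcs : CrossSperner F G) :
    2 ≤ n ∧
    (F.card + G.card : ℤ) ≤ 2 ^ n - 2 ^ ((n + 1) / 2) - 2 ^ (n / 2) + 2 ∧
    (n ≠ 3 →
      ((F.card + G.card : ℤ) = 2 ^ n - 2 ^ ((n + 1) / 2) - 2 ^ (n / 2) + 2 ↔
        ∃ A : Finset ℕ,
          (F = {A} ∧ (A.card = (n + 1) / 2 ∨ A.card = n / 2) ∧
            G = (groundSet n).powerset.filter (fun B => ¬ A ⊆ B ∧ ¬ B ⊆ A)) ∨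
          (G = {A} ∧ (A.card = (n + 1) / 2 ∨ A.card = n / 2) ∧
            F = (groundSet n).powerset.filter (fun B => ¬ A ⊆ B ∧ ¬ B ⊆ A)))) := by
  have hn : (groundSet n).card = n := by simp [groundSet]
  have h2n := hcs.two_le_card hF hG hFne hGne
  rw [hn] at h2n
  refine ⟨h2n, ?_⟩
  have hbig := hcs.card_add_card_le_of_two_le hF hG
  have hsing := fun A (H : Finset (Finset ℕ)) =>
    CrossSperner.card_singleton_add_card_le (X := groundSet n) (A := A) (G := H)
  rw [hn] at hbig
  simp only [hn] at hsing
  have hF0 := hFne.card_pos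
  have hG0 := hGne.card_pos
  by_cases hF1 : F.card = 1
  · obtain ⟨A, rfl⟩ := card_eq_one.1 hF1
    obtain ⟨hle, heq⟩ := hsing A G (mem_powerset.1 (hF (mem_singleton_self A))) hG hcs
    rw [card_singleton, Nat.cast_one]
    refine ⟨hle, fun _ => ⟨fun h => ⟨A, Or.inl ⟨rfl, heq.1 h⟩⟩, ?_⟩⟩
    rintro ⟨B, ⟨hAB, hB⟩ | ⟨rfl, hB, hFB⟩⟩
    · rw [← singleton_inj.1 hAB] at hB
      exact heq.2 hB
    · have := (hsing B {A} (mem_powerset.1 (hG (mem_singleton_self B))) hF hcs.symm).2.2 ⟨hB, hFB⟩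
      simpa using this
  by_cases hG1 : G.card = 1
  · obtain ⟨A, rfl⟩ := card_eq_one.1 hG1
    obtain ⟨hle, heq⟩ := hsing A F (mem_powerset.1 (hG (mem_singleton_self A))) hF hcs.symm
    rw [card_singleton, Nat.cast_one, add_comm (F.card : ℤ)]
    refine ⟨hle, fun _ => ⟨fun h => ⟨A, Or.inr ⟨rfl, heq.1 h⟩⟩, ?_⟩⟩
    rintro ⟨B, ⟨rfl, -⟩ | ⟨hAB, hB⟩⟩
    · exact absurd (card_singleton B) hF1
    · rw [← singleton_inj.1 hAB] at hB
      exact heq.2 hB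
  obtain ⟨hle, hlt⟩ := hbig (by omega) (by omega)
  refine ⟨hle, fun hn3 => ⟨fun h => absurd h (hlt hn3).ne, ?_⟩⟩
  rintro ⟨B, ⟨rfl, -⟩ | ⟨rfl, -⟩⟩
  · exact absurd (card_singleton B) hF1
  · exact absurd (card_singleton B) hG1
end
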